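/- For all spherical residues R, T of a building X: the projection proj_R(T) is the unique maximal element of the interval [R,T] which contains R; moreover it is the unique spherical residue π containing R such that d(π,T) = min { d(σ,T) : σ ∈ Res(X), σ contains R }, where d denotes the root-distance. -/

import Mathlib

open Filter Topology

noncomputable section

variable {B : Type} {W : Type} [Group W] {M : CoxeterMatrix B}

/-- The subset `I` of the simple reflections is of *spherical type* if the standard
parabolic subgroup `W_I` it generates is finite. -/
def SphType (cs : CoxeterSystem M W) (I : Set B) : Prop :=
  ((Subgroup.closure (cs.simple '' I) : Subgroup W) : Set W).Finite

/-- A building of type `(W,S)`, in the chamber-system (`W`-metric) approach: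
a nonempty set of chambers with a Weyl-group-valued distance function `delta`. -/
structure Bldg (cs : CoxeterSystem M W) where
  Chamber : Type
  chamber_nonempty : Nonempty Chamber
  delta : Chamber → Chamber → W
  delta_eq_one_iff : ∀ C D, delta C D = 1 ↔ C = D
  delta_mem_pair : ∀ C D E (i : B), delta D E = cs.simple i →
    delta C E = delta C D * cs.simple i ∨ delta C E = delta C D
  delta_eq_of_length : ∀ C D E (i : B), delta D E = cs.simple i →
    cs.length (delta C D * cs.simple i) = cs.length (delta C D) + 1 →
    delta C E = delta C D * cs.simple i
  exists_delta : ∀ C D (i : B), ∃ E, delta D E = cs.simple i ∧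
    delta C E = delta C D * cs.simple i

namespace Bldg

variable {cs : CoxeterSystem M W} (X : Bldg cs)

instance : Nonempty X.Chamber := X.chamber_nonempty

instance : TopologicalSpace X.Chamber := ⊥
instance : DiscreteTopology X.Chamber := ⟨rfl⟩

/-- The gallery distance between two chambers. -/
def gdist (C D : X.Chamber) : ℕ := cs.length (X.delta C D)

/-- The `I`-residue of the chamber `C`. -/
def residue (I : Set B) (C : X.Chamber) : Set X.Chamber :=
  {D | X.delta C D ∈ Subgroup.closure (cs.simple '' I)}

/-- `R` is a spherical residue. -/
def IsSphResidue (R : Set X.Chamber) : Prop :=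
  ∃ (I : Set B) (C : X.Chamber), SphType cs I ∧ R = X.residue I C

/-- `R` is a panel, i.e. an `{s}`-residue. -/
def IsPanel (R : Set X.Chamber) : Prop :=
  ∃ (i : B) (C : X.Chamber), R = X.residue {i} C

/-- The set `Res(X)` of spherical residues of `X`. -/
def Res : Type := {R : Set X.Chamber // X.IsSphResidue R}

/-- The set of panels of `X`. -/
def Panel : Type := {R : Set X.Chamber // X.IsPanel R}

instance : Nonempty X.Res := by
  obtain ⟨C⟩ := X.chamber_nonempty
  exact ⟨⟨X.residue ∅ C, ∅, C, by simp [SphType], rfl⟩⟩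

instance : TopologicalSpace X.Res := ⊥
instance : DiscreteTopology X.Res := ⟨rfl⟩

/-- `R₁ ≤ R₂` : the spherical residue `R₂` contains `R₁`, i.e. `R₂ ⊆ R₁` as
sets of chambers. -/
def leRes (R₁ R₂ : X.Res) : Prop := R₂.1 ⊆ R₁.1

/-- The star `St(σ)` of a spherical residue. -/
def star (σ : X.Res) : Set X.Res := {τ | X.leRes σ τ}

/-- The gate (combinatorial projection) of the chamber `C` onto the residue `R` :
the unique chamber of `R` through which pass minimal galleries from `C` to any
chamber of `R`. -/
def gate (R : Set X.Chamber) (C : X.Chamber) : X.Chamber :=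
  Classical.epsilon fun D => D ∈ R ∧ ∀ E ∈ R, X.gdist C E = X.gdist C D + X.gdist D E

/-- The combinatorial projection of the residue `T` onto the residue `R`,
as a set of chambers. -/
def projSet (R T : Set X.Chamber) : Set X.Chamber := X.gate R '' T

/-- The combinatorial projection `proj_R(T)` of the spherical residue `T` onto
the spherical residue `R`, as a spherical residue. -/
def projRes (R T : X.Res) : X.Res :=
  Classical.epsilon fun U : X.Res => U.1 = X.projSet R.1 T.1

/-- The map `proj_r : Res(X) → ∏_σ St(σ)` underlying the maximal combinatorial
bordification. -/
def projr (R : X.Res) : X.Res → X.Res := fun σ => X.projRes σ R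

/-- The maximal combinatorial bordification `Cr(X)`: the closure of the image
of `proj_r`, each factor of the product being discrete. -/
def Cr : Set (X.Res → X.Res) := closure (Set.range X.projr)

/-- The map `proj_c : ch(X) → ∏_{σ panel} St(σ)` underlying the minimal
combinatorial bordification. -/
def projc (C : X.Chamber) : X.Panel → X.Chamber := fun σ => X.gate σ.1 C

/-- The minimal combinatorial bordification `Cc(X)`. -/
def Cc : Set (X.Panel → X.Chamber) := closure (Set.range X.projc)

/-- A set of spherical residues is closed if it contains, with any residue,
all residues that it contains (in the order `leRes`). -/
def ClosedResSet (𝓡 : Set X.Res) : Prop :=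
  ∀ R₁ R₂ : X.Res, X.leRes R₁ R₂ → R₂ ∈ 𝓡 → R₁ ∈ 𝓡

/-- A set of spherical residues is convex if it is closed and stable under
combinatorial projections. -/
def ConvexResSet (𝓡 : Set X.Res) : Prop :=
  X.ClosedResSet 𝓡 ∧ ∀ R₁ ∈ 𝓡, ∀ R₂ ∈ 𝓡, X.projRes R₁ R₂ ∈ 𝓡

/-- The closure of a set of spherical residues. -/
def resClosure (𝓡 : Set X.Res) : Set X.Res := ⋂₀ {𝓢 | X.ClosedResSet 𝓢 ∧ 𝓡 ⊆ 𝓢}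

/-- The convex hull of a set of spherical residues. -/
def convHull (𝓡 : Set X.Res) : Set X.Res := ⋂₀ {𝓢 | X.ConvexResSet 𝓢 ∧ 𝓡 ⊆ 𝓢}

/-- The convex hull `Conv(R₁,R₂)` of two spherical residues. -/
def conv2 (R₁ R₂ : X.Res) : Set X.Res := X.convHull {R₁, R₂}

/-- `α : W → ch(X)` is an apartment map: an isometric embedding of the Coxeter
complex. -/
def IsApartMap (α : W → X.Chamber) : Prop :=
  Function.Injective α ∧ ∀ v w : W, X.delta (α v) (α w) = v⁻¹ * w

/-- `A` is an apartment of `X`. -/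
def IsApartment (A : Set X.Chamber) : Prop :=
  ∃ α : W → X.Chamber, X.IsApartMap α ∧ A = Set.range α

/-- The residue `R` lies in the apartment `A`. -/
def LiesIn (R : X.Res) (A : Set X.Chamber) : Prop := (R.1 ∩ A).Nonempty

/-- `φ` is a root (half-apartment) of the apartment `A`. -/
def IsRootOf (A φ : Set X.Chamber) : Prop :=
  ∃ α : W → X.Chamber, X.IsApartMap α ∧ A = Set.range α ∧
    ∃ t : W, cs.IsReflection t ∧ φ = α '' {v : W | cs.length v < cs.length (t * v)}

/-- The residue `R` is contained in the root `φ` of the apartment `A`. -/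
def ContainedInRoot (R : X.Res) (A φ : Set X.Chamber) : Prop := R.1 ∩ A ⊆ φ

/-- `Φ_A(R₁,R₂)`: the set of roots of `A` containing `R₁` but not `R₂`. -/
def PhiSep (A : Set X.Chamber) (R₁ R₂ : X.Res) : Set (Set X.Chamber) :=
  {φ | X.IsRootOf A φ ∧ X.ContainedInRoot R₁ A φ ∧ ¬ X.ContainedInRoot R₂ A φ}

/-- A choice of apartment in which both `R₁` and `R₂` lie. -/
def chooseApt (R₁ R₂ : X.Res) : Set X.Chamber :=
  Classical.epsilon fun A : Set X.Chamber => X.IsApartment A ∧ X.LiesIn R₁ A ∧ X.LiesIn R₂ A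

/-- The root-distance between two spherical residues:
`d(R₁,R₂) = ½|Φ_A(R₁,R₂)| + ½|Φ_A(R₂,R₁)|` for an apartment `A` containing both. -/
def rootDist (R₁ R₂ : X.Res) : ℝ :=
  (((X.PhiSep (X.chooseApt R₁ R₂) R₁ R₂).ncard +
    (X.PhiSep (X.chooseApt R₁ R₂) R₂ R₁).ncard : ℕ) : ℝ) / 2

/-- The interval `[R₁,R₂]` determined by two spherical residues. -/
def interval (R₁ R₂ : X.Res) : Set X.Res :=
  {σ | X.rootDist R₁ R₂ = X.rootDist R₁ σ + X.rootDist σ R₂}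

/-- The retraction onto the apartment given by the apartment map `α`, centred at
the chamber `α 1`. -/
def retr (α : W → X.Chamber) (D : X.Chamber) : X.Chamber := α (X.delta (α 1) D)

/-- The retraction onto an apartment, acting on spherical residues: it maps the
`I`-residue of a chamber `D` to the `I`-residue of the retracted chamber. -/
def retrRes (α : W → X.Chamber) (R : X.Res) : X.Res :=
  Classical.epsilon fun T : X.Res =>
    ∃ (I : Set B) (D : X.Chamber), R.1 = X.residue I D ∧ T.1 = X.residue I (X.retr α D)

/-- The sequence `(R_n)` of spherical residues converges to `ξ` in the maximal
combinatorial bordification. -/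
def ConvSeq (ξ : X.Res → X.Res) (R : ℕ → X.Res) : Prop :=
  Tendsto (fun n => X.projr (R n)) atTop (nhds ξ)

/-- `Q(x, (R_n)) = ⋃_k ⋂_{n ≥ k} Conv(x, R_n)`. -/
def Qseq (x : X.Res) (R : ℕ → X.Res) : Set X.Res :=
  ⋃ k : ℕ, ⋂ n : ℕ, ⋂ _ : k ≤ n, X.conv2 x (R n)

/-- The combinatorial sector `Q(x,ξ)` based at `x` and pointing towards `ξ`. -/
def Qsector (x : X.Res) (ξ : X.Res → X.Res) : Set X.Res :=
  X.Qseq x (Classical.epsilon (X.ConvSeq ξ))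

/-- `Φ_A(ξ)`: the set of roots of the apartment `A` (with apartment map `α`) in
which every sequence of residues converging to `ξ`, retracted to `A`, eventually
lies. -/
def PhiXi (A : Set X.Chamber) (α : W → X.Chamber) (ξ : X.Res → X.Res) :
    Set (Set X.Chamber) :=
  {φ | X.IsRootOf A φ ∧ ∀ R : ℕ → X.Res, X.ConvSeq ξ R →
    ∃ N : ℕ, ∀ n > N, X.ContainedInRoot (X.retrRes α (R n)) A φ}

/-- `Φ_A(x)`: the set of roots of `A` containing the residue `x`. -/
def PhiRes (A : Set X.Chamber) (x : X.Res) : Set (Set X.Chamber) :=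
  {φ | X.IsRootOf A φ ∧ X.ContainedInRoot x A φ}

/-- The spherical residue `x` is a chamber (an `∅`-residue). -/
def IsChamberRes (x : X.Res) : Prop :=
  ∃ C : X.Chamber, x.1 = X.residue (∅ : Set B) C

/-- The automorphism group of the building: all permutations of the chambers
preserving the Weyl distance. -/
def autGroup : Subgroup (Equiv.Perm X.Chamber) where
  carrier := {g | ∀ C D : X.Chamber, X.delta (g C) (g D) = X.delta C D}
  one_mem' := by intro C D; simp
  mul_mem' := by
    intro a b ha hb C D
    simp only [Equiv.Perm.mul_apply]
    rw [ha, hb]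
  inv_mem' := by
    intro a ha C D
    have := ha (a⁻¹ C) (a⁻¹ D)
    simpa using this.symm

/-- `Aut(X)` as a type. -/
abbrev Aut : Type := ↥X.autGroup

/-- The topology of pointwise convergence on `Aut(X)` (the chamber set being
discrete). -/
instance : TopologicalSpace X.Aut :=
  TopologicalSpace.induced
    (fun g : X.Aut => ((g : Equiv.Perm X.Chamber) : X.Chamber → X.Chamber)) inferInstance

/-- The action of an automorphism on spherical residues. -/
def actRes (g : X.Aut) (R : X.Res) : X.Res :=
  Classical.epsilon fun T : X.Res => T.1 = (g : Equiv.Perm X.Chamber) '' R.1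

/-- The action of an automorphism on panels. -/
def actPanel (g : X.Aut) (σ : X.Panel) : X.Panel :=
  haveI : Nonempty X.Panel := ⟨σ⟩
  Classical.epsilon fun τ : X.Panel => τ.1 = (g : Equiv.Perm X.Chamber) '' σ.1

/-- The action of `Aut(X)` on the maximal combinatorial bordification:
`(g·f)(σ) = g·f(g⁻¹σ)`. -/
def actCr (g : X.Aut) (f : X.Res → X.Res) : X.Res → X.Res :=
  fun σ => X.actRes g (f (X.actRes g⁻¹ σ))

/-- The action of `Aut(X)` on the minimal combinatorial bordification. -/
def actCc (g : X.Aut) (f : X.Panel → X.Chamber) : X.Panel → X.Chamber :=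
  fun σ => (g : Equiv.Perm X.Chamber) (f (X.actPanel g⁻¹ σ))

/-- The building is locally finite: `S` is finite and panels are finite. -/
def LocallyFinite : Prop :=
  Finite B ∧ ∀ R : Set X.Chamber, X.IsPanel R → R.Finite

/-- The building is thick: every panel contains at least three chambers. -/
def Thick : Prop := ∀ R : Set X.Chamber, X.IsPanel R → 3 ≤ R.ncard

/-- The subgroup `G ≤ Aut(X)` acts strongly transitively: transitively on pairs
`(C, A)` of a chamber contained in an apartment. -/
def StronglyTransitive (G : Subgroup X.Aut) : Prop :=
  ∀ (C C' : X.Chamber) (A A' : Set X.Chamber),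
    X.IsApartment A → C ∈ A → X.IsApartment A' → C' ∈ A' →
    ∃ g ∈ G, (g : Equiv.Perm X.Chamber) C = C' ∧ (g : Equiv.Perm X.Chamber) '' A = A'

end Bldg

/-- A topological group is amenable if there is a left-invariant mean on the
space of bounded continuous real-valued functions on it. -/
def IsAmenableGroup (H : Type*) [Group H] [TopologicalSpace H] : Prop :=
  ∃ m : BoundedContinuousFunction H ℝ →ₗ[ℝ] ℝ,
    m 1 = 1 ∧ (∀ f : BoundedContinuousFunction H ℝ, (∀ x, 0 ≤ f x) → 0 ≤ m f) ∧
    ∀ (g : H) (f₁ f₂ : BoundedContinuousFunction H ℝ),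
      (∀ x, f₂ x = f₁ (g * x)) → m f₂ = m f₁

/-- A subset `K` of a topological group is topologically locally finite if every
finite subset of `K` generates a subgroup with compact closure. -/
def IsTLFSet {H : Type*} [Group H] [TopologicalSpace H] (K : Set H) : Prop :=
  ∀ s : Finset H, (s : Set H) ⊆ K →
    IsCompact (closure ((Subgroup.closure (s : Set H) : Subgroup H) : Set H))

/-- The space of closed subgroups of a topological group. -/
def ChabautySpace (H : Type*) [Group H] [TopologicalSpace H] : Type _ :=
  {K : Subgroup H // IsClosed (K : Set H)}

instance {H : Type*} [Group H] [TopologicalSpace H] : Nonempty (ChabautySpace H) :=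
  ⟨⟨⊤, by rw [Subgroup.coe_top]; exact isClosed_univ⟩⟩

/-- The Chabauty topology on the space of closed subgroups. -/
instance {H : Type*} [Group H] [TopologicalSpace H] : TopologicalSpace (ChabautySpace H) :=
  TopologicalSpace.generateFrom
    ({s | ∃ K : Set H, IsCompact K ∧ s = {L : ChabautySpace H | (L.1 : Set H) ∩ K = ∅}} ∪
     {s | ∃ U : Set H, IsOpen U ∧ s = {L : ChabautySpace H | ((L.1 : Set H) ∩ U).Nonempty}})

namespace Bldg

variable {cs : CoxeterSystem M W} (X : Bldg cs)

/-- The stabiliser in `G` of a spherical residue, as a set. -/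
def gstab (G : Subgroup X.Aut) (R : X.Res) : Set ↥G :=
  {g : ↥G | X.actRes (g : X.Aut) R = R}

/-- The stabiliser in `G` of a spherical residue, as a closed subgroup of `G`. -/
def gstabC (G : Subgroup X.Aut) (R : X.Res) : ChabautySpace ↥G :=
  Classical.epsilon fun L : ChabautySpace ↥G => (L.1 : Set ↥G) = X.gstab G R

/-- `D_ξ`: the union over `x ∈ Res(X)` of the pointwise fixators in `G` of the
combinatorial sectors `Q(x,ξ)`. -/
def gfixSector (G : Subgroup X.Aut) (ξ : X.Res → X.Res) : Set ↥G :=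
  {g : ↥G | ∃ x : X.Res, ∀ R ∈ X.Qsector x ξ, X.actRes (g : X.Aut) R = R}

/-- `D_ξ` as a closed subgroup of `G` (an element of the Chabauty space). -/
def DxiC (G : Subgroup X.Aut) (ξ : X.Res → X.Res) : ChabautySpace ↥G :=
  Classical.epsilon fun L : ChabautySpace ↥G => (L.1 : Set ↥G) = X.gfixSector G ξ

/-- The set of periodic elements of the stabiliser `G_ξ`. -/
def periodicStab (G : Subgroup X.Aut) (ξ : X.Res → X.Res) : Set ↥G :=
  {g : ↥G | X.actCr (g : X.Aut) ξ = ξ ∧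
    IsCompact (closure ((Subgroup.zpowers g : Subgroup ↥G) : Set ↥G))}

/-- The horofunction compactification of the chamber graph, with base point `y₀`. -/
def horoCh (y₀ : X.Chamber) : Set (X.Chamber → ℝ) :=
  closure (Set.range fun C : X.Chamber =>
    fun y : X.Chamber => (X.gdist C y : ℝ) - (X.gdist C y₀ : ℝ))

/-- The horofunction compactification of `(Res(X), root-distance)`, with base
point `z₀`. -/
def horoRes (z₀ : X.Res) : Set (X.Res → ℝ) :=
  closure (Set.range fun R : X.Res =>
    fun y : X.Res => X.rootDist R y - X.rootDist R z₀)

/-- The action of `Aut(X)` on horofunctions of the chamber graph. -/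
def actHoroCh (y₀ : X.Chamber) (g : X.Aut) (h : X.Chamber → ℝ) : X.Chamber → ℝ :=
  fun y => h (((g⁻¹ : X.Aut) : Equiv.Perm X.Chamber) y) -
    h (((g⁻¹ : X.Aut) : Equiv.Perm X.Chamber) y₀)

/-- The action of `Aut(X)` on horofunctions of `(Res(X), root-distance)`. -/
def actHoroRes (z₀ : X.Res) (g : X.Aut) (h : X.Res → ℝ) : X.Res → ℝ :=
  fun y => h (X.actRes g⁻¹ y) - h (X.actRes g⁻¹ z₀)

end Bldg
namespace CoxeterSystem

/-! ### The sign representation on reflections -/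

open Classical in
/-- The action of a simple reflection on `W × ZMod 2` which conjugates the first coordinate and
flips the second one exactly at the simple reflection itself. -/
def signAct (cs : CoxeterSystem M W) (i : B) : Function.End (W × ZMod 2) := fun p =>
  (cs.simple i * p.1 * cs.simple i, p.2 + if p.1 = cs.simple i then 1 else 0)

open Classical in
lemma signAct_mul_pow (cs : CoxeterSystem M W) (i j : B) (n : ℕ) (t : W) (e : ZMod 2) :
    ((cs.signAct i * cs.signAct j) ^ n) (t, e) =
      ((cs.simple i * cs.simple j) ^ n * t * ((cs.simple i * cs.simple j) ^ n)⁻¹,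
        e + ∑ l ∈ Finset.range (2 * n),
          if t = cs.simple j * (cs.simple i * cs.simple j) ^ l then 1 else 0) := by
  induction n with
  | zero => simp; rfl
  | succ n ih =>
    have hs : SemiconjBy (cs.simple j) (cs.simple i * cs.simple j)⁻¹
        (cs.simple i * cs.simple j) := by
      simp [SemiconjBy, mul_assoc]
    have hflip : cs.simple j * ((cs.simple i * cs.simple j) ^ n)⁻¹ =
        (cs.simple i * cs.simple j) ^ n * cs.simple j := by
      have := hs.pow_right n
      rwa [inv_pow] at this
    have hflip' : ((cs.simple i * cs.simple j) ^ n)⁻¹ * cs.simple j =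
        cs.simple j * (cs.simple i * cs.simple j) ^ n := by
      rw [inv_mul_eq_iff_eq_mul, ← mul_assoc, ← hflip]
      simp
    have hstep : ((cs.signAct i * cs.signAct j) ^ (n + 1)) (t, e) =
        cs.signAct i (cs.signAct j (((cs.signAct i * cs.signAct j) ^ n) (t, e))) := by
      rw [pow_succ']; rfl
    rw [hstep, ih]
    simp only [signAct, Prod.mk.injEq]
    set p := cs.simple i * cs.simple j with hp
    refine ⟨?_, ?_⟩
    · simp [pow_succ', hp, mul_assoc]
    · rw [show 2 * (n + 1) = 2 * n + 1 + 1 by ring, Finset.sum_range_succ, Finset.sum_range_succ,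
        ← add_assoc, ← add_assoc]
      have h1 : (p ^ n * t * (p ^ n)⁻¹ = cs.simple j) ↔ t = cs.simple j * p ^ (2 * n) := by
        rw [mul_inv_eq_iff_eq_mul, ← eq_inv_mul_iff_mul_eq, ← mul_assoc, hflip', mul_assoc,
          two_mul, pow_add]
      have h2 : (cs.simple j * (p ^ n * t * (p ^ n)⁻¹) * cs.simple j = cs.simple i) ↔
          t = cs.simple j * p ^ (2 * n + 1) := by
        have e1 : cs.simple j * p ^ (2 * n + 1) =
            (p ^ n)⁻¹ * (cs.simple j * cs.simple i * cs.simple j) * p ^ n := by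
          rw [show 2 * n + 1 = n + 1 + n by ring, pow_add, pow_add, ← mul_assoc, ← mul_assoc,
            ← hflip']
          simp [hp, mul_assoc]
        rw [e1]
        constructor
        · intro h
          rw [← h]
          simp [mul_assoc]
        · intro h
          rw [h]
          simp [mul_assoc]
      simp only [h1, h2]

lemma isLiftable_signAct (cs : CoxeterSystem M W) : M.IsLiftable cs.signAct := by
  classical
  intro i j
  funext ⟨t, e⟩
  rw [signAct_mul_pow, cs.simple_mul_simple_pow, two_mul, Finset.sum_range_add]
  simp only [pow_add, cs.simple_mul_simple_pow, one_mul, CharTwo.add_self_eq_zero]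
  simp; rfl

/-- The sign representation of `W` on `W × ZMod 2`. -/
def signRep (cs : CoxeterSystem M W) : W →* Function.End (W × ZMod 2) :=
  cs.lift ⟨cs.signAct, cs.isLiftable_signAct⟩

/-- The reflection cocycle: for a reflection `t`, it is nonzero exactly when `t` is a right
inversion of `w`. -/
def reflSign (cs : CoxeterSystem M W) (w t : W) : ZMod 2 := (cs.signRep w (t, 0)).2

lemma signRep_simple (cs : CoxeterSystem M W) (i : B) : cs.signRep (cs.simple i) = cs.signAct i :=
  cs.lift_apply_simple cs.isLiftable_signAct i

lemma signRep_apply (cs : CoxeterSystem M W) (w t : W) (e : ZMod 2) :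
    cs.signRep w (t, e) = (w * t * w⁻¹, e + cs.reflSign w t) := by
  have hmul : ∀ (u v : W) (p : W × ZMod 2), cs.signRep (u * v) p =
      cs.signRep u (cs.signRep v p) := by
    intro u v p
    rw [map_mul]; rfl
  suffices h : ∃ f : W → ZMod 2, ∀ t e, cs.signRep w (t, e) = (w * t * w⁻¹, e + f t) by
    obtain ⟨f, hf⟩ := h
    rw [reflSign, hf, hf]
    simp
  induction w using cs.simple_induction_left with
  | one =>
    refine ⟨fun _ => 0, fun t e => ?_⟩
    rw [map_one]; simp; rfl
  | mul_simple_left w i ih =>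
    obtain ⟨f, hf⟩ := ih
    refine ⟨fun t => f t + (cs.signAct i (w * t * w⁻¹, 0)).2, fun t e => ?_⟩
    rw [hmul, hf, signRep_simple]
    simp [signAct, mul_assoc, add_assoc]

lemma reflSign_mul (cs : CoxeterSystem M W) (u v t : W) :
    cs.reflSign (u * v) t = cs.reflSign v t + cs.reflSign u (v * t * v⁻¹) := by
  have : cs.signRep (u * v) (t, 0) = cs.signRep u (cs.signRep v (t, 0)) := by
    rw [map_mul]; rfl
  rw [reflSign, this, signRep_apply, signRep_apply]
  simp

open Classical in
lemma reflSign_simple (cs : CoxeterSystem M W) (i : B) (t : W) :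
    cs.reflSign (cs.simple i) t = if t = cs.simple i then 1 else 0 := by
  rw [reflSign, signRep_simple]
  simp [signAct]

lemma reflSign_one (cs : CoxeterSystem M W) (t : W) : cs.reflSign 1 t = 0 := by
  rw [reflSign, map_one]; rfl

lemma length_mul_lt_of_reflSign_ne_zero (cs : CoxeterSystem M W) (w t : W)
    (h : cs.reflSign w t ≠ 0) : cs.length (w * t) < cs.length w := by
  classical
  induction hn : cs.length w generalizing w with
  | zero =>
    rw [cs.length_eq_zero_iff] at hn
    subst hn
    exact absurd (cs.reflSign_one t) h
  | succ n ih =>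
    obtain ⟨i, hi⟩ := cs.exists_leftDescent_of_ne_one (w := w) (by
      rintro rfl
      simp at hn)
    rw [cs.isLeftDescent_iff] at hi
    obtain ⟨v, rfl⟩ : ∃ v, w = cs.simple i * v := ⟨cs.simple i * w, by simp⟩
    rw [cs.simple_mul_simple_cancel_left] at hi
    by_cases hv : cs.reflSign v t = 0
    · rw [reflSign_mul, hv, reflSign_simple] at h
      have ht : v * t * v⁻¹ = cs.simple i := by
        by_contra hne
        simp [hne] at h
      have : cs.simple i * v * t = v := by
        rw [mul_inv_eq_iff_eq_mul] at ht
        rw [mul_assoc, ht, cs.simple_mul_simple_cancel_left]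
      rw [this]
      omega
    · have := ih v hv (by omega)
      have := cs.length_mul_le (cs.simple i) (v * t)
      rw [cs.length_simple, ← mul_assoc] at this
      omega

lemma IsReflection.reflSign_self {cs : CoxeterSystem M W} {t : W} (ht : cs.IsReflection t) :
    cs.reflSign t t = 1 := by
  obtain ⟨u, i, rfl⟩ := ht
  have h : cs.reflSign (u * u⁻¹) (u * cs.simple i * u⁻¹) = 0 := by
    rw [mul_inv_cancel, reflSign_one]
  rw [reflSign_mul] at h
  rw [reflSign_mul, reflSign_mul]
  simp only [mul_assoc, inv_inv, inv_mul_cancel, mul_one, inv_mul_cancel_left,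
    cs.simple_mul_simple_self, cs.inv_simple, reflSign_simple, if_true, one_mul] at h ⊢
  rw [add_comm 1 (cs.reflSign u _), ← add_assoc, h, zero_add]

/-- A reflection `t` is a right inversion of `w` iff the reflection cocycle does not vanish. -/
lemma IsReflection.length_mul_lt_iff {cs : CoxeterSystem M W} {t : W} (ht : cs.IsReflection t)
    (w : W) : cs.length (w * t) < cs.length w ↔ cs.reflSign w t ≠ 0 := by
  refine ⟨fun h h0 => ?_, cs.length_mul_lt_of_reflSign_ne_zero w t⟩
  have h1 : cs.reflSign (w * t) t ≠ 0 := by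
    rw [reflSign_mul, ht.reflSign_self]
    simp [h0]
  have := cs.length_mul_lt_of_reflSign_ne_zero _ _ h1
  rw [mul_assoc, ht.mul_self, mul_one] at this
  omega

end CoxeterSystem
namespace CoxeterSystem

/-! ### Half-spaces of the Coxeter complex -/

/-- `r` is the reflection along the wall bounding the half-space `H`: it exchanges the two sides,
and it maps `x` to `x s` for every simple edge `{x, x s}` crossing the wall. -/
structure IsWall (cs : CoxeterSystem M W) (H : Set W) (r : W) : Prop where
  mul_self : r * r = 1
  mul_mem_iff : ∀ x, r * x ∈ H ↔ x ∉ H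
  mul_eq_of_cross : ∀ x i, (x ∈ H ↔ x * cs.simple i ∉ H) → r * x = x * cs.simple i

/-- The translate by `u` of the half-space consisting of the elements on the positive side of the
reflection `t`. -/
def halfspace (cs : CoxeterSystem M W) (u t : W) : Set W :=
  {x | cs.length (u⁻¹ * x) < cs.length (t * (u⁻¹ * x))}

/-- The set of half-spaces of `W`. -/
def halfspaces (cs : CoxeterSystem M W) : Set (Set W) :=
  {H | ∃ u t, cs.IsReflection t ∧ H = cs.halfspace u t}

lemma IsReflection.length_lt_mul_iff {cs : CoxeterSystem M W} {t : W} (ht : cs.IsReflection t)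
    (x : W) : cs.length x < cs.length (t * x) ↔ cs.reflSign x⁻¹ t = 0 := by
  have h := ht.length_mul_lt_iff x⁻¹
  have e : cs.length (x⁻¹ * t) = cs.length (t * x) := by
    rw [← cs.length_inv (t * x), mul_inv_rev, ht.inv]
  rw [e, cs.length_inv] at h
  have hne := ht.length_mul_right_ne x
  rw [← not_iff_not, ← ne_eq (cs.reflSign _ _), ← h]
  omega

lemma IsReflection.isWall_one {cs : CoxeterSystem M W} {t : W} (ht : cs.IsReflection t) :
    cs.IsWall {x | cs.length x < cs.length (t * x)} t where
  mul_self := ht.mul_self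
  mul_mem_iff x := by
    have hne := ht.length_mul_right_ne x
    simp only [Set.mem_ofPred_eq, ← mul_assoc, ht.mul_self, one_mul]
    omega
  mul_eq_of_cross x i h := by
    classical
    simp only [Set.mem_ofPred_eq, ht.length_lt_mul_iff, mul_inv_rev, cs.inv_simple] at h
    rw [reflSign_mul, reflSign_simple] at h
    have hx : x⁻¹ * t * x⁻¹⁻¹ = cs.simple i := by
      by_contra hne
      rw [if_neg hne] at h
      simp at h
    rw [← hx]
    simp [mul_assoc]

lemma isWall_halfspace {cs : CoxeterSystem M W} {t : W} (ht : cs.IsReflection t) (u : W) :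
    cs.IsWall (cs.halfspace u t) (u * t * u⁻¹) where
  mul_self := by
    have := ht.mul_self
    simp [mul_assoc]
    rw [← mul_assoc t, this, one_mul, mul_inv_cancel]
  mul_mem_iff x := by
    have := ht.isWall_one.mul_mem_iff (u⁻¹ * x)
    simpa [halfspace, mul_assoc] using this
  mul_eq_of_cross x i h := by
    have := ht.isWall_one.mul_eq_of_cross (u⁻¹ * x) i (by simpa [halfspace, mul_assoc] using h)
    rw [mul_assoc, mul_assoc, this]
    simp [mul_assoc]

lemma exists_isWall {cs : CoxeterSystem M W} {H : Set W} (hH : H ∈ cs.halfspaces) :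
    ∃ r, cs.IsWall H r := by
  obtain ⟨u, t, ht, rfl⟩ := hH
  exact ⟨_, isWall_halfspace ht u⟩

lemma preimage_mul_mem_halfspaces {cs : CoxeterSystem M W} {H : Set W} (hH : H ∈ cs.halfspaces)
    (g : W) : (fun x => g * x) ⁻¹' H ∈ cs.halfspaces := by
  obtain ⟨u, t, ht, rfl⟩ := hH
  refine ⟨g⁻¹ * u, t, ht, ?_⟩
  ext x
  simp [halfspace, mul_assoc]

/-- The half-space containing `z` and bounded by the wall between `z` and `z s`. -/
lemma mem_halfspace_simple (cs : CoxeterSystem M W) (z : W) (i : B) :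
    z ∈ cs.halfspace z (cs.simple i) ∧ z * cs.simple i ∉ cs.halfspace z (cs.simple i) := by
  simp [halfspace]

lemma halfspace_simple_mem (cs : CoxeterSystem M W) (z : W) (i : B) :
    cs.halfspace z (cs.simple i) ∈ cs.halfspaces := ⟨z, _, cs.isReflection_simple i, rfl⟩

namespace IsWall

variable {cs : CoxeterSystem M W} {H : Set W} {r : W}

/-- Folding along a wall shortens the distance between elements on different sides. -/
lemma length_fold_lt (h : cs.IsWall H r) (a b : W) (hab : a ∈ H ↔ b ∉ H) :
    cs.length (a⁻¹ * (r * b)) < cs.length (a⁻¹ * b) := by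
  induction hn : cs.length (a⁻¹ * b) generalizing a with
  | zero =>
    rw [cs.length_eq_zero_iff, inv_mul_eq_one] at hn
    subst hn
    tauto
  | succ n ih =>
    obtain ⟨i, hi⟩ := cs.exists_leftDescent_of_ne_one (w := a⁻¹ * b) (by
      intro h1
      rw [h1] at hn
      simp at hn)
    rw [cs.isLeftDescent_iff] at hi
    have e : ∀ c, (a * cs.simple i)⁻¹ * c = cs.simple i * (a⁻¹ * c) := by
      intro c
      simp [mul_assoc]
    by_cases hc : a ∈ H ↔ a * cs.simple i ∉ H
    · have h1 := h.mul_eq_of_cross a i hc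
      have h2 : a⁻¹ * (r * b) = cs.simple i * (a⁻¹ * b) := by
        rw [← e, ← h1, mul_inv_rev, mul_assoc, inv_eq_of_mul_eq_one_left h.mul_self]
      rw [h2]
      omega
    · have := ih (a * cs.simple i) (by tauto) (by rw [e]; omega)
      rw [e] at this
      have h3 := cs.length_simple_mul (a⁻¹ * (r * b)) i
      omega

/-- If a wall separates two elements of a coset of `W_I`, its reflection stabilises the coset. -/
lemma conj_mem_closure (h : cs.IsWall H r) (I : Set B) {x v : W}
    (hv : v ∈ Subgroup.closure (cs.simple '' I)) (hx : x ∈ H ↔ x * v ∉ H) :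
    x⁻¹ * r * x ∈ Subgroup.closure (cs.simple '' I) := by
  induction hv using Subgroup.closure_induction generalizing x with
  | mem s hs =>
    obtain ⟨i, hi, rfl⟩ := hs
    rw [mul_assoc, h.mul_eq_of_cross x i hx, inv_mul_cancel_left]
    exact Subgroup.subset_closure ⟨i, hi, rfl⟩
  | one => simp at hx
  | mul v₁ v₂ hv₁ _ ih₁ ih₂ =>
    by_cases hc : x ∈ H ↔ x * v₁ ∉ H
    · exact ih₁ hc
    · have := ih₂ (x := x * v₁) (by rw [mul_assoc]; tauto)
      have h2 := mul_mem (mul_mem hv₁ this) (inv_mem hv₁)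
      simpa [mul_assoc] using h2
  | inv v hv ih =>
    have := ih (x := x * v⁻¹) (by rw [inv_mul_cancel_right]; tauto)
    have h2 := mul_mem (mul_mem (inv_mem hv) this) hv
    simpa [mul_assoc] using h2

end IsWall

/-- A half-space is determined by any edge crossing its wall. -/
lemma eq_halfspace_simple {cs : CoxeterSystem M W} {H : Set W} (hH : H ∈ cs.halfspaces) {z : W}
    {i : B} (hz : z ∈ H) (hz' : z * cs.simple i ∉ H) : H = cs.halfspace z (cs.simple i) := by
  obtain ⟨r, hr⟩ := exists_isWall hH
  have e := hr.mul_eq_of_cross z i (by tauto)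
  have e' : r * (z * cs.simple i) = z := by rw [← e, ← mul_assoc, hr.mul_self, one_mul]
  have hl : ∀ x y : W, cs.length (x⁻¹ * y) = cs.length (y⁻¹ * x) := by
    intro x y
    rw [← cs.length_inv (y⁻¹ * x)]
    simp
  have e2 : ∀ x, cs.simple i * (z⁻¹ * x) = (z * cs.simple i)⁻¹ * x := by
    intro x
    simp [mul_assoc]
  ext x
  rw [halfspace, Set.mem_ofPred_eq, e2, hl z x, hl (z * cs.simple i) x]
  by_cases hx : x ∈ H
  · have := hr.length_fold_lt x (z * cs.simple i) (by tauto)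
    rw [e'] at this
    tauto
  · have := hr.length_fold_lt x z (by tauto)
    rw [e] at this
    simp only [hx, false_iff]
    omega

/-- Only finitely many half-spaces separate two given elements. -/
lemma finite_halfspaces_separating (cs : CoxeterSystem M W) (p q : W) :
    {H ∈ cs.halfspaces | p ∈ H ↔ q ∉ H}.Finite := by
  obtain ⟨v, rfl⟩ : ∃ v, q = p * v := ⟨p⁻¹ * q, by simp⟩
  induction v using cs.simple_induction_right with
  | one => simp
  | mul_simple_right v i ih =>
    refine (ih.union (Set.toFinite {cs.halfspace (p * v) (cs.simple i),
      cs.halfspace (p * v * cs.simple i) (cs.simple i)})).subset ?_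
    rintro H ⟨hH, hpq⟩
    rw [← mul_assoc] at hpq
    by_cases hc : p ∈ H ↔ p * v ∉ H
    · exact Or.inl ⟨hH, hc⟩
    · right
      by_cases hm : p * v ∈ H
      · exact Or.inl (eq_halfspace_simple hH hm (by tauto))
      · refine Or.inr (eq_halfspace_simple hH (by tauto) ?_)
        rwa [cs.simple_mul_simple_cancel_right]

/-- If lengths do not add up in `w * v`, some reflection is a common inversion. -/
lemma exists_common_inversion (cs : CoxeterSystem M W) (w v : W)
    (h : cs.length (w * v) < cs.length w + cs.length v) :
    ∃ t, cs.IsReflection t ∧ cs.length (t * v) < cs.length v ∧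
      cs.length (w * t) < cs.length w := by
  induction hn : cs.length v generalizing v with
  | zero =>
    rw [cs.length_eq_zero_iff] at hn
    subst hn
    simp at h
  | succ n ih =>
    obtain ⟨i, hi⟩ := cs.exists_rightDescent_of_ne_one (w := v) (by
      rintro rfl
      simp at hn)
    rw [cs.isRightDescent_iff] at hi
    obtain ⟨v, rfl⟩ : ∃ v', v = v' * cs.simple i := ⟨v * cs.simple i, by simp⟩
    rw [cs.simple_mul_simple_cancel_right] at hi
    rw [← mul_assoc] at h
    by_cases hv : cs.length (w * v) < cs.length w + cs.length v
    · obtain ⟨t, ht, h1, h2⟩ := ih v hv (by omega)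
      have h3 := cs.length_mul_simple (t * v) i
      rw [mul_assoc] at h3
      exact ⟨t, ht, by omega, h2⟩
    · have hle := cs.length_mul_le w v
      have hd := cs.length_mul_simple (w * v) i
      set t := v * cs.simple i * v⁻¹ with ht_def
      have ht : cs.IsReflection t := ⟨v, i, rfl⟩
      have e1 : t * v = v * cs.simple i := by simp [t]
      have e2 : t * (v * cs.simple i) = v := by simp [t, mul_assoc]
      refine ⟨t, ht, by rw [e2]; omega, ?_⟩
      have hwall := ht.isWall_one
      by_contra hcon
      have e3 : cs.length (t * w⁻¹) = cs.length (w * t) := by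
        rw [← cs.length_inv (w * t), mul_inv_rev, ht.inv]
      have hne := ht.length_mul_left_ne w
      have := hwall.length_fold_lt w⁻¹ (v * cs.simple i) (by
        simp only [Set.mem_ofPred_eq, e2, e3, cs.length_inv]
        omega)
      rw [e2, inv_inv, ← mul_assoc] at this
      omega

/-- An element of minimal length in its coset of `W_I` has lengths adding up with `W_I`. -/
lemma length_mul_eq_add_of_forall_le (cs : CoxeterSystem M W) (I : Set B) (w : W)
    (hw : ∀ v ∈ Subgroup.closure (cs.simple '' I), cs.length w ≤ cs.length (w * v))
    {v : W} (hv : v ∈ Subgroup.closure (cs.simple '' I)) :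
    cs.length (w * v) = cs.length w + cs.length v := by
  by_contra hne
  have hle := cs.length_mul_le w v
  obtain ⟨t, ht, h1, h2⟩ := cs.exists_common_inversion w v (by omega)
  have hmem := ht.isWall_one.conj_mem_closure I (x := 1) hv (by
    simp only [Set.mem_ofPred_eq, mul_one, one_mul, cs.length_one]
    have := ht.odd_length.pos
    omega)
  have := hw t (by simpa using hmem)
  omega

/-- An element all of whose inversions lie in a subgroup `G` is a product of simple reflections
of `G`. -/
lemma mem_closure_of_inversions_mem (cs : CoxeterSystem M W) (G : Subgroup W) (u : W)
    (hu : ∀ t, cs.IsReflection t → cs.length (t * u) < cs.length u → t ∈ G) :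
    u ∈ Subgroup.closure (cs.simple '' {i | cs.simple i ∈ G}) := by
  induction hn : cs.length u generalizing u with
  | zero =>
    rw [cs.length_eq_zero_iff] at hn
    rw [hn]
    exact one_mem _
  | succ n ih =>
    obtain ⟨i, hi⟩ := cs.exists_leftDescent_of_ne_one (w := u) (by
      rintro rfl
      simp at hn)
    have hiG := hu _ (cs.isReflection_simple i) hi
    rw [cs.isLeftDescent_iff] at hi
    have hrec := ih (cs.simple i * u) (fun t ht hlt => ?_) (by omega)
    · have := mul_mem (Subgroup.subset_closure (Set.mem_image_of_mem cs.simple hiG)) hrec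
      rwa [cs.simple_mul_simple_cancel_left] at this
    · have hwall := ht.isWall_one
      have hne := ht.length_mul_right_ne (cs.simple i)
      have hb : cs.simple i ∈ {x | cs.length x < cs.length (t * x)} := by
        by_contra hb
        have e := hwall.mul_eq_of_cross 1 i (by
          have := ht.odd_length.pos
          simp only [Set.mem_ofPred_eq, mul_one, one_mul, cs.length_one] at hb ⊢
          tauto)
        rw [mul_one, one_mul] at e
        rw [e, cs.simple_mul_simple_cancel_left] at hlt
        omega
      have := hwall.length_fold_lt (cs.simple i) (cs.simple i * u) (by
        simp only [Set.mem_ofPred_eq] at hb ⊢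
        omega)
      rw [cs.inv_simple, cs.simple_mul_simple_cancel_left] at this
      have hG := hu (cs.simple i * t * cs.simple i) (by
        have := ht.conj (cs.simple i)
        rwa [cs.inv_simple] at this) (by simpa [mul_assoc] using this)
      have := mul_mem (mul_mem hiG hG) hiG
      simpa [mul_assoc] using this

/-- Let `w` be minimal in `W_I w` and `u ∈ W_I` closest to `w * v`, where `v ∈ W_J`. Then `u`
is a product of simple reflections lying in `W_I ∩ w W_J w⁻¹`. -/
lemma mem_closure_inter_conj (cs : CoxeterSystem M W) (I J : Set B) (w u v : W)
    (hw : ∀ x ∈ Subgroup.closure (cs.simple '' I), cs.length w ≤ cs.length (x * w))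
    (hu : u ∈ Subgroup.closure (cs.simple '' I)) (hv : v ∈ Subgroup.closure (cs.simple '' J))
    (hmin : ∀ x ∈ Subgroup.closure (cs.simple '' I),
      cs.length ((w * v)⁻¹ * u) ≤ cs.length ((w * v)⁻¹ * u * x)) :
    u ∈ Subgroup.closure (cs.simple '' {i | cs.simple i ∈ Subgroup.closure (cs.simple '' I) ∧
      w⁻¹ * cs.simple i * w ∈ Subgroup.closure (cs.simple '' J)}) := by
  let G : Subgroup W := Subgroup.closure (cs.simple '' I) ⊓
    (Subgroup.closure (cs.simple '' J)).comap (MulAut.conj w⁻¹).toMonoidHom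
  have hG : ∀ x, x ∈ G ↔ x ∈ Subgroup.closure (cs.simple '' I) ∧
      w⁻¹ * x * w ∈ Subgroup.closure (cs.simple '' J) := by
    intro x
    simp [G, Subgroup.mem_inf]
  have key := cs.mem_closure_of_inversions_mem G u (fun t ht hlt => ?_)
  · simpa only [hG] using key
  have hwall := ht.isWall_one
  have htI : t ∈ Subgroup.closure (cs.simple '' I) := by
    have := hwall.conj_mem_closure I (x := 1) hu (by
      have := ht.odd_length.pos
      simp only [Set.mem_ofPred_eq, mul_one, one_mul, cs.length_one]
      omega)
    simpa using this
  refine (hG t).2 ⟨htI, hwall.conj_mem_closure J (x := w) hv ?_⟩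
  have h1 : w ∈ {x | cs.length x < cs.length (t * x)} := by
    have := hw t htI
    have := ht.length_mul_right_ne w
    simp only [Set.mem_ofPred_eq]
    omega
  have h2 : w * v ∉ {x | cs.length x < cs.length (t * x)} := by
    intro hmem
    have h3 := hwall.length_fold_lt (w * v) u (by
      simp only [Set.mem_ofPred_eq] at hmem ⊢
      omega)
    have h4 := hmin (u⁻¹ * t * u) (mul_mem (mul_mem (inv_mem hu) htI) hu)
    rw [show (w * v)⁻¹ * u * (u⁻¹ * t * u) = (w * v)⁻¹ * (t * u) by simp [mul_assoc]] at h4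
    omega
  tauto

end CoxeterSystem
namespace CoxeterSystem

/-! ### Cosets of parabolic subgroups and the half-spaces containing them -/

/-- `P` is a left coset of the standard parabolic subgroup `W_I`. -/
structure IsCoset (cs : CoxeterSystem M W) (I : Set B) (P : Set W) : Prop where
  nonempty : P.Nonempty
  mem_iff : ∀ p ∈ P, ∀ x, x ∈ P ↔ p⁻¹ * x ∈ Subgroup.closure (cs.simple '' I)

/-- The half-spaces containing `P`. -/
def halfspacesOver (cs : CoxeterSystem M W) (P : Set W) : Set (Set W) :=
  {H ∈ cs.halfspaces | P ⊆ H}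

/-- `p` is an element of `P` at minimal distance from `q`. -/
def IsClosest (cs : CoxeterSystem M W) (P : Set W) (q p : W) : Prop :=
  p ∈ P ∧ ∀ p' ∈ P, cs.length (q⁻¹ * p) ≤ cs.length (q⁻¹ * p')

variable {cs : CoxeterSystem M W} {I J : Set B} {P P' Q N : Set W}

lemma IsCoset.mul_mem_of_cut (hP : cs.IsCoset I P) {H : Set W} {r : W} (h : cs.IsWall H r)
    {x y z : W} (hx : x ∈ P) (hy : y ∈ P) (hxy : x ∈ H ↔ y ∉ H) (hz : z ∈ P) : r * z ∈ P := by
  have h1 := h.conj_mem_closure I (x := x) ((hP.mem_iff x hx y).1 hy) (by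
    rwa [mul_inv_cancel_left])
  rw [hP.mem_iff x hx]
  have h2 := mul_mem h1 ((hP.mem_iff x hx z).1 hz)
  simpa [mul_assoc] using h2

/-- A coset of a parabolic subgroup is the intersection of the half-spaces containing it. -/
lemma IsCoset.subset_of_halfspacesOver_subset (hP : cs.IsCoset I P)
    (h : cs.halfspacesOver P ⊆ cs.halfspacesOver N) : N ⊆ P := by
  intro x hx
  by_contra hxP
  obtain ⟨p₀, hp₀⟩ := hP.nonempty
  obtain ⟨y, hy, hmin⟩ := exists_minimalFor_of_wellFoundedLT (· ∈ P)
    (fun y => cs.length (y⁻¹ * x)) ⟨p₀, hp₀⟩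
  have hne : y⁻¹ * x ≠ 1 := by
    rw [Ne, inv_mul_eq_one]
    rintro rfl
    exact hxP hy
  obtain ⟨i, hi⟩ := cs.exists_leftDescent_of_ne_one hne
  have hnot : y * cs.simple i ∉ P := by
    intro hmem
    have hlt : cs.length ((y * cs.simple i)⁻¹ * x) < cs.length (y⁻¹ * x) := by
      simpa [mul_assoc, IsLeftDescent] using hi
    have := hmin hmem hlt.le
    simp only at this
    omega
  have hmem := cs.halfspace_simple_mem y i
  obtain ⟨r, hr⟩ := exists_isWall hmem
  obtain ⟨h1, h2⟩ := cs.mem_halfspace_simple y i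
  have hsub : P ⊆ cs.halfspace y (cs.simple i) := by
    intro z hz
    by_contra hzH
    apply hnot
    rw [← hr.mul_eq_of_cross y i (by tauto)]
    exact hP.mul_mem_of_cut hr hy hz (by tauto) hy
  have hxH := (h ⟨hmem, hsub⟩).2 hx
  have : cs.length (y⁻¹ * x) < cs.length (cs.simple i * (y⁻¹ * x)) := hxH
  rw [IsLeftDescent] at hi
  omega

/-- If a wall cuts the coset `P`, an element and its closest point in `P` lie on the same side. -/
lemma IsCoset.mem_iff_of_isClosest (hP : cs.IsCoset I P) {H : Set W} {r : W} (h : cs.IsWall H r)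
    {x y : W} (hx : x ∈ P) (hy : y ∈ P) (hxy : x ∈ H ↔ y ∉ H) {q p : W}
    (hp : cs.IsClosest P q p) : p ∈ H ↔ q ∈ H := by
  by_contra hne
  have h1 := h.length_fold_lt q p (by tauto)
  have h2 := hp.2 _ (hP.mul_mem_of_cut h hx hy hxy hp.1)
  omega

/-- `N` is the projection of `Q` to `P`: it consists of the closest points of elements of `Q`. -/
structure IsProj (cs : CoxeterSystem M W) (P Q N : Set W) : Prop where
  exists_proj : ∀ q ∈ Q, ∃ p ∈ N, cs.IsClosest P q p
  exists_of_mem : ∀ p ∈ N, ∃ q ∈ Q, cs.IsClosest P q p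

lemma IsProj.subset (h : cs.IsProj P Q N) : N ⊆ P := fun p hp =>
  let ⟨_, _, hq⟩ := h.exists_of_mem p hp
  hq.1

/-- The half-spaces containing a projection `N` of `Q` to `P` are those containing `P`, and those
containing `Q` and meeting `P`. -/
lemma IsProj.mem_halfspacesOver_iff (hN : cs.IsProj P Q N) (hP : cs.IsCoset I P)
    (hNne : N.Nonempty) (H : Set W) : H ∈ cs.halfspacesOver N ↔
      H ∈ cs.halfspacesOver P ∨ (H ∈ cs.halfspacesOver Q ∧ (P ∩ H).Nonempty) := by
  constructor
  · rintro ⟨hH, hNH⟩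
    by_cases hPH : P ⊆ H
    · exact Or.inl ⟨hH, hPH⟩
    obtain ⟨y, hy, hyH⟩ := Set.not_subset.1 hPH
    obtain ⟨x, hx⟩ := hNne
    have hxP := hN.subset hx
    obtain ⟨r, hr⟩ := exists_isWall hH
    refine Or.inr ⟨⟨hH, fun q hq => ?_⟩, x, hxP, hNH hx⟩
    obtain ⟨p, hp, hpq⟩ := hN.exists_proj q hq
    have := hNH hx
    exact (hP.mem_iff_of_isClosest hr hxP hy (by tauto) hpq).1 (hNH hp)
  · rintro (⟨hH, hPH⟩ | ⟨⟨hH, hQH⟩, x, hxP, hxH⟩)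
    · exact ⟨hH, hN.subset.trans hPH⟩
    · refine ⟨hH, fun p hp => ?_⟩
      obtain ⟨q, hq, hpq⟩ := hN.exists_of_mem p hp
      by_contra hpH
      obtain ⟨r, hr⟩ := exists_isWall hH
      exact hpH ((hP.mem_iff_of_isClosest hr hxP hpq.1 (by tauto) hpq).2 (hQH hq))

/-- The number of half-spaces containing exactly one of `P` and `Q`. -/
def sepCard (cs : CoxeterSystem M W) (P Q : Set W) : ℕ :=
  (symmDiff (cs.halfspacesOver P) (cs.halfspacesOver Q)).ncard

lemma finite_halfspacesOver_sdiff (cs : CoxeterSystem M W) (hP : P.Nonempty) (hQ : Q.Finite) :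
    (cs.halfspacesOver P \ cs.halfspacesOver Q).Finite := by
  obtain ⟨p, hp⟩ := hP
  refine (hQ.biUnion fun q _ => cs.finite_halfspaces_separating p q).subset ?_
  rintro H ⟨⟨hH, hPH⟩, hQH⟩
  obtain ⟨q, hq, hqH⟩ := Set.not_subset.1 fun h => hQH ⟨hH, h⟩
  have := hPH hp
  exact Set.mem_biUnion hq ⟨hH, by tauto⟩

lemma finite_symmDiff_halfspacesOver (cs : CoxeterSystem M W) (hP : P.Nonempty) (hPf : P.Finite)
    (hQ : Q.Nonempty) (hQf : Q.Finite) :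
    (symmDiff (cs.halfspacesOver P) (cs.halfspacesOver Q)).Finite :=
  (cs.finite_halfspacesOver_sdiff hP hQf).union (cs.finite_halfspacesOver_sdiff hQ hPf)

lemma sepCard_eq_add (cs : CoxeterSystem M W) (hP : P.Nonempty) (hPf : P.Finite)
    (hQ : Q.Nonempty) (hQf : Q.Finite) : cs.sepCard P Q =
      (cs.halfspacesOver P \ cs.halfspacesOver Q).ncard +
        (cs.halfspacesOver Q \ cs.halfspacesOver P).ncard := by
  rw [sepCard, Set.symmDiff_def]
  exact Set.ncard_union_eq (Set.disjoint_left.2 fun H h1 h2 => h1.2 h2.1)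
    (cs.finite_halfspacesOver_sdiff hP hQf) (cs.finite_halfspacesOver_sdiff hQ hPf)

/-- Additivity of the separation count through `P ⊆ P'` forces every half-space containing `P` to
contain `P'` or `Q`, and conversely. -/
lemma sepCard_add_iff (cs : CoxeterSystem M W) (hPP' : P ⊆ P') (hP : P.Nonempty)
    (hP'f : P'.Finite) (hQ : Q.Nonempty) (hQf : Q.Finite) :
    cs.sepCard P' Q = cs.sepCard P' P + cs.sepCard P Q ↔
      cs.halfspacesOver P ⊆ cs.halfspacesOver P' ∪ cs.halfspacesOver Q := by
  have hf1 := cs.finite_symmDiff_halfspacesOver (hP.mono hPP') hP'f hP (hP'f.subset hPP')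
  have hf2 := cs.finite_symmDiff_halfspacesOver hP (hP'f.subset hPP') hQ hQf
  have hsub : cs.halfspacesOver P' ⊆ cs.halfspacesOver P := fun H hH =>
    ⟨hH.1, hPP'.trans hH.2⟩
  simp only [sepCard]
  generalize cs.halfspacesOver P = A at *
  generalize cs.halfspacesOver P' = A' at *
  generalize cs.halfspacesOver Q = C at *
  have hdisj : Disjoint (symmDiff A' A) (symmDiff A C) ↔ A ⊆ A' ∪ C := by
    rw [Set.disjoint_left]
    constructor
    · intro h H hH
      by_contra hc
      simp only [Set.mem_union, not_or] at hc
      exact h (Or.inr ⟨hH, hc.1⟩) (Or.inl ⟨hH, hc.2⟩)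
    · rintro h H (h1 | h1) (h2 | h2)
      · exact h1.2 h2.1
      · exact h1.2 (hsub h1.1)
      · rcases h h1.1 with h3 | h3
        · exact h1.2 h3
        · exact h2.2 h3
      · exact h2.2 h1.1
  rw [← hdisj]
  have hun : symmDiff A' C ⊆ symmDiff A' A ∪ symmDiff A C := symmDiff_triangle A' A C
  have hfu := hf1.union hf2
  have hadd := Set.ncard_union_add_ncard_inter (symmDiff A' A) (symmDiff A C) hf1 hf2
  constructor
  · intro h
    have h1 := Set.ncard_le_ncard hun hfu
    have h2 : ((symmDiff A' A) ∩ (symmDiff A C)).ncard = 0 := by omega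
    rw [Set.ncard_eq_zero (hf1.subset Set.inter_subset_left)] at h2
    exact Set.disjoint_iff_inter_eq_empty.2 h2
  · intro h
    have e := h.symmDiff_eq_sup
    rw [symmDiff_assoc, symmDiff_symmDiff_cancel_left] at e
    rw [← Set.ncard_union_eq h hf1 hf2, e]
    rfl

/-- The projection `N` of `Q` to `P'` lies between `P'` and `Q`. -/
lemma IsProj.sepCard_add (hN : cs.IsProj P' Q N) (hP' : cs.IsCoset I P') (hP'f : P'.Finite)
    (hNne : N.Nonempty) (hQ : Q.Nonempty) (hQf : Q.Finite) :
    cs.sepCard P' Q = cs.sepCard P' N + cs.sepCard N Q := by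
  rw [cs.sepCard_add_iff hN.subset hNne hP'f hQ hQf]
  intro H hH
  rcases (hN.mem_halfspacesOver_iff hP' hNne H).1 hH with h | h
  · exact Or.inl h
  · exact Or.inr h.1

/-- The projection is the smallest coset in `P'` lying between `P'` and `Q`. -/
lemma IsProj.subset_of_sepCard_add (hN : cs.IsProj P' Q N) (hP' : cs.IsCoset I P')
    (hP'f : P'.Finite) (hNne : N.Nonempty) (hQ : Q.Nonempty) (hQf : Q.Finite)
    (hP : cs.IsCoset J P) (hPP' : P ⊆ P')
    (h : cs.sepCard P' Q = cs.sepCard P' P + cs.sepCard P Q) : N ⊆ P := by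
  rw [cs.sepCard_add_iff hPP' hP.nonempty hP'f hQ hQf] at h
  refine hP.subset_of_halfspacesOver_subset fun H hH => ?_
  rw [hN.mem_halfspacesOver_iff hP' hNne]
  rcases h hH with h1 | h1
  · exact Or.inl h1
  · obtain ⟨p, hp⟩ := hP.nonempty
    exact Or.inr ⟨h1, p, hPP' hp, hH.2 hp⟩

lemma IsProj.symmDiff_subset (hN : cs.IsProj P' Q N) (hP' : cs.IsCoset I P')
    (hNne : N.Nonempty) (hP : P.Nonempty) (hPP' : P ⊆ P') :
    symmDiff (cs.halfspacesOver N) (cs.halfspacesOver Q) ⊆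
      symmDiff (cs.halfspacesOver P) (cs.halfspacesOver Q) := by
  rintro H (⟨h1, h2⟩ | ⟨h1, h2⟩)
  · rcases (hN.mem_halfspacesOver_iff hP' hNne H).1 h1 with h | h
    · exact Or.inl ⟨⟨h.1, hPP'.trans h.2⟩, h2⟩
    · exact absurd h.1 h2
  · refine Or.inr ⟨h1, fun h => h2 ((hN.mem_halfspacesOver_iff hP' hNne H).2 (Or.inr ⟨h1, ?_⟩))⟩
    obtain ⟨p, hp⟩ := hP
    exact ⟨p, hPP' hp, h.2 hp⟩

/-- The projection minimises the separation count from `Q`. -/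
lemma IsProj.sepCard_le (hN : cs.IsProj P' Q N) (hP' : cs.IsCoset I P') (hP'f : P'.Finite)
    (hNne : N.Nonempty) (hQ : Q.Nonempty) (hQf : Q.Finite) (hP : P.Nonempty) (hPP' : P ⊆ P') :
    cs.sepCard N Q ≤ cs.sepCard P Q :=
  Set.ncard_le_ncard (hN.symmDiff_subset hP' hNne hP hPP')
    (cs.finite_symmDiff_halfspacesOver hP (hP'f.subset hPP') hQ hQf)

/-- The projection is the only coset minimising the separation count from `Q`. -/
lemma IsProj.eq_of_sepCard_le {K : Set B} (hN : cs.IsProj P' Q N) (hP' : cs.IsCoset I P')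
    (hP'f : P'.Finite) (hNK : cs.IsCoset K N) (hQ : Q.Nonempty) (hQf : Q.Finite)
    (hP : cs.IsCoset J P) (hPP' : P ⊆ P') (h : cs.sepCard P Q ≤ cs.sepCard N Q) : P = N := by
  have e := Set.eq_of_subset_of_ncard_le (hN.symmDiff_subset hP' hNK.nonempty hP.nonempty hPP') h
    (cs.finite_symmDiff_halfspacesOver hP.nonempty (hP'f.subset hPP') hQ hQf)
  have e' := symmDiff_left_injective _ e
  exact (hNK.subset_of_halfspacesOver_subset e'.le).antisymm
    (hP.subset_of_halfspacesOver_subset e'.ge)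

end CoxeterSystem


namespace Bldg

variable {cs : CoxeterSystem M W} (X : Bldg cs)

/-! ### The Weyl distance -/

lemma delta_self (C : X.Chamber) : X.delta C C = 1 := (X.delta_eq_one_iff C C).2 rfl

lemma delta_eq_simple_symm {C D : X.Chamber} {i : B} (h : X.delta C D = cs.simple i) :
    X.delta D C = cs.simple i := by
  rcases X.delta_mem_pair D C D i h with h1 | h1
  · rw [delta_self, eq_comm, mul_eq_one_iff_eq_inv, cs.inv_simple] at h1
    exact h1
  · rw [delta_self, eq_comm, delta_eq_one_iff] at h1
    subst h1
    have := congrArg cs.length h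
    simp [delta_self] at this

lemma delta_eq_mul {D E C : X.Chamber} (h : cs.length (X.delta D E * X.delta E C) =
    cs.length (X.delta D E) + cs.length (X.delta E C)) :
    X.delta D C = X.delta D E * X.delta E C := by
  induction hn : cs.length (X.delta E C) generalizing C with
  | zero =>
    rw [cs.length_eq_zero_iff] at hn
    rw [hn, mul_one, ((X.delta_eq_one_iff _ _).1 hn)]
  | succ n ih =>
    obtain ⟨i, hi⟩ := cs.exists_rightDescent_of_ne_one (w := X.delta E C) (by
      intro h1
      rw [h1] at hn
      simp at hn)
    rw [cs.isRightDescent_iff] at hi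
    obtain ⟨F, hF, hEF⟩ := X.exists_delta E C i
    have h1 := cs.length_mul_le (X.delta D E) (X.delta E F)
    have h2 := cs.length_mul_simple (X.delta D E * X.delta E C) i
    rw [mul_assoc, ← hEF] at h2
    rw [← hEF] at hi
    have h3 := ih (C := F) (by omega) (by omega)
    rw [X.delta_eq_of_length D F C i (X.delta_eq_simple_symm hF), h3, hEF]
    · simp [mul_assoc]
    · rw [h3, hEF]
      simp only [mul_assoc, cs.simple_mul_simple_self, mul_one]
      rw [← hEF]
      omega

lemma delta_symm (C D : X.Chamber) : X.delta D C = (X.delta C D)⁻¹ := by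
  induction hn : cs.length (X.delta C D) generalizing D with
  | zero =>
    rw [cs.length_eq_zero_iff] at hn
    rw [hn, inv_one, delta_eq_one_iff, ((X.delta_eq_one_iff _ _).1 hn)]
  | succ n ih =>
    obtain ⟨i, hi⟩ := cs.exists_rightDescent_of_ne_one (w := X.delta C D) (by
      intro h1
      rw [h1] at hn
      simp at hn)
    rw [cs.isRightDescent_iff] at hi
    obtain ⟨F, hF, hCF⟩ := X.exists_delta C D i
    have h3 := ih F (by rw [hCF]; omega)
    have e : X.delta D F * X.delta F C = (X.delta C D)⁻¹ := by
      rw [hF, h3, hCF]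
      simp
    rw [X.delta_eq_mul (E := F), e]
    rw [e, hF, h3, hCF, cs.length_inv, cs.length_inv, cs.length_simple]
    omega

lemma exists_delta_mul (C D : X.Chamber) (v : W) :
    ∃ E, X.delta D E = v ∧ X.delta C E = X.delta C D * v := by
  induction hn : cs.length v generalizing v with
  | zero =>
    rw [cs.length_eq_zero_iff] at hn
    exact ⟨D, by rw [hn, delta_self], by rw [hn, mul_one]⟩
  | succ n ih =>
    obtain ⟨i, hi⟩ := cs.exists_rightDescent_of_ne_one (w := v) (by
      intro h1
      rw [h1] at hn
      simp at hn)
    rw [cs.isRightDescent_iff] at hi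
    obtain ⟨F, hF, hCF⟩ := ih (v * cs.simple i) (by omega)
    obtain ⟨E, hE, hCE⟩ := X.exists_delta C F i
    refine ⟨E, ?_, by rw [hCE, hCF]; simp [mul_assoc]⟩
    rw [X.delta_eq_of_length D F E i hE, hF]
    · simp
    · rw [hF]
      simp
      omega

lemma inv_mul_delta_mem_closure (C : X.Chamber) {D E : X.Chamber} {I : Set B}
    (h : X.delta D E ∈ Subgroup.closure (cs.simple '' I)) :
    (X.delta C D)⁻¹ * X.delta C E ∈ Subgroup.closure (cs.simple '' I) := by
  have step : ∀ v, ∀ s ∈ cs.simple '' I, (∀ E, X.delta D E = v →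
      (X.delta C D)⁻¹ * X.delta C E ∈ Subgroup.closure (cs.simple '' I)) →
      ∀ E, X.delta D E = v * s →
      (X.delta C D)⁻¹ * X.delta C E ∈ Subgroup.closure (cs.simple '' I) := by
    rintro v _ ⟨i, hi, rfl⟩ ih E hE
    obtain ⟨F, hF, hDF⟩ := X.exists_delta D E i
    have h1 := ih F (by rw [hDF, hE]; simp)
    have hi' := Subgroup.subset_closure (Set.mem_image_of_mem cs.simple hi)
    rcases X.delta_mem_pair C F E i (X.delta_eq_simple_symm hF) with h2 | h2
    · rw [h2, ← mul_assoc]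
      exact mul_mem h1 hi'
    · rwa [h2]
  refine Subgroup.closure_induction_right (p := fun v _ => ∀ E, X.delta D E = v →
      (X.delta C D)⁻¹ * X.delta C E ∈ Subgroup.closure (cs.simple '' I)) ?_ ?_ ?_ h E rfl
  · intro E hE
    rw [(X.delta_eq_one_iff _ _).1 hE]
    simp
  · intro v _ s hs ih
    exact step v s hs ih
  · rintro v _ s hs ih
    have : s⁻¹ ∈ cs.simple '' I := by
      obtain ⟨i, hi, rfl⟩ := hs
      exact ⟨i, hi, by simp⟩
    exact step v _ this ih

lemma length_inv_mul_delta_le (C D E : X.Chamber) :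
    cs.length ((X.delta C D)⁻¹ * X.delta C E) ≤ cs.length (X.delta D E) := by
  induction hn : cs.length (X.delta D E) generalizing E with
  | zero =>
    rw [cs.length_eq_zero_iff] at hn
    rw [(X.delta_eq_one_iff _ _).1 hn]
    simp
  | succ n ih =>
    obtain ⟨i, hi⟩ := cs.exists_rightDescent_of_ne_one (w := X.delta D E) (by
      intro h1
      rw [h1] at hn
      simp at hn)
    rw [cs.isRightDescent_iff] at hi
    obtain ⟨F, hF, hDF⟩ := X.exists_delta D E i
    have h1 := ih F (by rw [hDF]; omega)
    rcases X.delta_mem_pair C F E i (X.delta_eq_simple_symm hF) with h2 | h2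
    · rw [h2, ← mul_assoc]
      have := cs.length_mul_le ((X.delta C D)⁻¹ * X.delta C F) (cs.simple i)
      rw [cs.length_simple] at this
      omega
    · rw [h2]
      omega

/-! ### Residues and gates -/

lemma mem_residue_self (I : Set B) (C : X.Chamber) : C ∈ X.residue I C := by
  simp [residue, delta_self, one_mem]

lemma mem_residue_iff {I : Set B} {C D : X.Chamber} (hD : D ∈ X.residue I C) (E : X.Chamber) :
    E ∈ X.residue I C ↔ X.delta D E ∈ Subgroup.closure (cs.simple '' I) := by
  have hD' : X.delta C D ∈ Subgroup.closure (cs.simple '' I) := hD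
  constructor
  · intro hE
    have hDC : X.delta D C ∈ Subgroup.closure (cs.simple '' I) := by
      rw [X.delta_symm C D]
      exact inv_mem hD'
    have := X.inv_mul_delta_mem_closure D (D := C) (E := E) hE
    exact (Subgroup.mul_mem_cancel_left _ (inv_mem hDC)).1 this
  · intro hE
    have := X.inv_mul_delta_mem_closure C hE
    exact (Subgroup.mul_mem_cancel_left _ (inv_mem hD')).1 this

/-- `D` is a chamber of `R = X.residue I D` closest to `C`. -/
def IsGate (I : Set B) (C D : X.Chamber) : Prop :=
  ∀ v ∈ Subgroup.closure (cs.simple '' I),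
    cs.length (X.delta C D) ≤ cs.length (X.delta C D * v)

variable {X} in
lemma IsGate.length_mul {I : Set B} {C D : X.Chamber} (h : X.IsGate I C D) {v : W}
    (hv : v ∈ Subgroup.closure (cs.simple '' I)) :
    cs.length (X.delta C D * v) = cs.length (X.delta C D) + cs.length v :=
  cs.length_mul_eq_add_of_forall_le I _ h hv

variable {X} in
lemma IsGate.delta_eq {I : Set B} {C D E : X.Chamber} (h : X.IsGate I C D)
    (hE : X.delta D E ∈ Subgroup.closure (cs.simple '' I)) :
    X.delta C E = X.delta C D * X.delta D E :=
  X.delta_eq_mul (h.length_mul hE)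

variable {X} in
lemma IsGate.gate_eq {I : Set B} {c C D : X.Chamber} (h : X.IsGate I C D)
    (hD : D ∈ X.residue I c) : X.gate (X.residue I c) C = D := by
  have hspec : ∀ E ∈ X.residue I c, X.gdist C E = X.gdist C D + X.gdist D E := by
    intro E hE
    have hE' := (X.mem_residue_iff hD E).1 hE
    rw [gdist, h.delta_eq hE', h.length_mul hE']
    rfl
  have hg := Classical.epsilon_spec (p := fun D => D ∈ X.residue I c ∧
    ∀ E ∈ X.residue I c, X.gdist C E = X.gdist C D + X.gdist D E) ⟨D, hD, hspec⟩
  change X.gate (X.residue I c) C ∈ _ ∧ _ at hg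
  have h1 := hspec _ hg.1
  have h2 := hg.2 _ hD
  change _ = X.gdist C (X.gate (X.residue I c) C) + _ at h2
  have h3 : X.gdist D (X.gate (X.residue I c) C) = 0 := by omega
  rw [gdist, cs.length_eq_zero_iff, delta_eq_one_iff] at h3
  exact h3.symm

lemma exists_isGate (I : Set B) (c C : X.Chamber) : ∃ D ∈ X.residue I c, X.IsGate I C D := by
  obtain ⟨D, hD, hmin⟩ := exists_minimalFor_of_wellFoundedLT (· ∈ X.residue I c)
    (fun D => cs.length (X.delta C D)) ⟨c, X.mem_residue_self I c⟩
  refine ⟨D, hD, fun v hv => ?_⟩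
  obtain ⟨E, hE, hCE⟩ := X.exists_delta_mul C D v
  rw [← hCE]
  have hE' : E ∈ X.residue I c := (X.mem_residue_iff hD E).2 (by rwa [hE])
  by_contra hlt
  exact hlt (hmin hE' (by simp only; omega))

lemma gate_mem (I : Set B) (c C : X.Chamber) : X.gate (X.residue I c) C ∈ X.residue I c := by
  obtain ⟨D, hD, h⟩ := X.exists_isGate I c C
  rwa [h.gate_eq hD]

lemma isGate_gate (I : Set B) (c C : X.Chamber) :
    X.IsGate I C (X.gate (X.residue I c) C) := by
  obtain ⟨D, hD, h⟩ := X.exists_isGate I c C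
  rwa [h.gate_eq hD]

end Bldg

namespace Bldg

variable {cs : CoxeterSystem M W} (X : Bldg cs)

/-! ### Projections between residues -/

/-- The projection of a residue to a residue is a residue, and the two projections between
residues induce inverse bijections between their images. -/
lemma exists_projSet_eq_residue (I J : Set B) (c d : X.Chamber) :
    ∃ (K : Set B) (D₀ : X.Chamber),
      Subgroup.closure (cs.simple '' K) ≤ Subgroup.closure (cs.simple '' I) ∧
      X.projSet (X.residue I c) (X.residue J d) = X.residue K D₀ ∧
      ∀ D ∈ X.residue K D₀,
        X.gate (X.residue I c) (X.gate (X.residue J d) D) = D := by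
  obtain ⟨⟨D₀, E₀⟩, ⟨hD₀, hE₀⟩, hmin⟩ := exists_minimalFor_of_wellFoundedLT
    (fun p : X.Chamber × X.Chamber => p.1 ∈ X.residue I c ∧ p.2 ∈ X.residue J d)
    (fun p => cs.length (X.delta p.1 p.2)) ⟨(c, d), X.mem_residue_self I c, X.mem_residue_self J d⟩
  simp only at hD₀ hE₀
  have hmin' : ∀ D ∈ X.residue I c, ∀ E ∈ X.residue J d,
      cs.length (X.delta D₀ E₀) ≤ cs.length (X.delta D E) := by
    intro D hD E hE
    by_contra hlt
    exact hlt (hmin (j := (D, E)) ⟨hD, hE⟩ (by simp only; omega))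
  have hg₁ : X.IsGate I E₀ D₀ := by
    intro v hv
    obtain ⟨D, hD, hE₀D⟩ := X.exists_delta_mul E₀ D₀ v
    have := hmin' D ((X.mem_residue_iff hD₀ D).2 (by rwa [hD])) E₀ hE₀
    rwa [← hE₀D, X.delta_symm D₀, X.delta_symm D, cs.length_inv, cs.length_inv]
  have hg₂ : X.IsGate J D₀ E₀ := by
    intro v hv
    obtain ⟨E, hE, hD₀E⟩ := X.exists_delta_mul D₀ E₀ v
    have := hmin' D₀ hD₀ E ((X.mem_residue_iff hE₀ E).2 (by rwa [hE]))
    rwa [← hD₀E]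
  set w := X.delta D₀ E₀ with hw
  have hE₀D₀ : X.delta E₀ D₀ = w⁻¹ := X.delta_symm D₀ E₀
  set K : Set B := {i | cs.simple i ∈ Subgroup.closure (cs.simple '' I) ∧
    w⁻¹ * cs.simple i * w ∈ Subgroup.closure (cs.simple '' J)} with hK
  have hKI : Subgroup.closure (cs.simple '' K) ≤ Subgroup.closure (cs.simple '' I) := by
    rw [Subgroup.closure_le]
    rintro _ ⟨i, hi, rfl⟩
    exact hi.1
  have hKJ : Subgroup.closure (cs.simple '' K) ≤
      (Subgroup.closure (cs.simple '' J)).comap (MulAut.conj w⁻¹).toMonoidHom := by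
    rw [Subgroup.closure_le]
    rintro _ ⟨i, hi, rfl⟩
    simpa using hi.2
  have key : ∀ D ∈ X.residue K D₀, ∃ E ∈ X.residue J d,
      X.gate (X.residue I c) E = D ∧ X.gate (X.residue J d) D = E := by
    intro D hD
    have hx : X.delta D₀ D ∈ Subgroup.closure (cs.simple '' K) := hD
    have hy : w⁻¹ * X.delta D₀ D * w ∈ Subgroup.closure (cs.simple '' J) := by
      simpa using hKJ hx
    have hE₀D := hg₁.delta_eq (hKI hx)
    obtain ⟨E, hE, hDE⟩ := X.exists_delta_mul D E₀ (w⁻¹ * X.delta D₀ D * w)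
    rw [X.delta_symm E₀ D, hE₀D, hE₀D₀] at hDE
    have hDE' : X.delta D E = w := by
      rw [hDE]
      simp [mul_assoc]
    have hED : X.delta E D = w⁻¹ := by rw [X.delta_symm D E, hDE']
    have hE' : E ∈ X.residue J d := (X.mem_residue_iff hE₀ E).2 (by rwa [hE])
    have hD' : D ∈ X.residue I c := (X.mem_residue_iff hD₀ D).2 (hKI hx)
    have g1 : X.IsGate I E D := by
      intro v hv
      rw [hED, ← hE₀D₀]
      exact hg₁ v hv
    have g2 : X.IsGate J D E := by
      intro v hv
      rw [hDE']
      exact hg₂ v hv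
    exact ⟨E, hE', g1.gate_eq hD', g2.gate_eq hE'⟩
  refine ⟨K, D₀, hKI, Set.Subset.antisymm ?_ ?_, ?_⟩
  · rintro _ ⟨E, hE, rfl⟩
    have hv := (X.mem_residue_iff hE₀ E).1 hE
    have hD₀E := hg₂.delta_eq hv
    have hD := X.gate_mem I c E
    have hgate := X.isGate_gate I c E
    set D := X.gate (X.residue I c) E
    have hu := (X.mem_residue_iff hD₀ D).1 hD
    have hED : X.delta E D = (w * X.delta E₀ E)⁻¹ * X.delta D₀ D := by
      have := hgate.delta_eq ((X.mem_residue_iff hD D₀).1 hD₀)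
      rw [X.delta_symm D₀ E, X.delta_symm D₀ D, hD₀E] at this
      rw [this]
      simp [mul_assoc]
    refine cs.mem_closure_inter_conj I J w (X.delta D₀ D) (X.delta E₀ E) ?_ hu hv ?_
    · intro x hx
      have := hg₁ x⁻¹ (inv_mem hx)
      rwa [hE₀D₀, ← mul_inv_rev, cs.length_inv, cs.length_inv] at this
    · rw [← hED]
      exact hgate
  · intro D hD
    obtain ⟨E, hE, h1, -⟩ := key D hD
    exact ⟨E, hE, h1⟩
  · intro D hD
    obtain ⟨E, hE, h1, h2⟩ := key D hD
    rw [h2, h1]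

lemma projRes_coe (R T : X.Res) : (X.projRes R T).1 = X.projSet R.1 T.1 := by
  refine Classical.epsilon_spec (p := fun U : X.Res => U.1 = X.projSet R.1 T.1) ?_
  obtain ⟨R, I, c, hI, rfl⟩ := R
  obtain ⟨T, J, d, hJ, rfl⟩ := T
  obtain ⟨K, D₀, hK, h, -⟩ := X.exists_projSet_eq_residue I J c d
  exact ⟨⟨X.residue K D₀, K, D₀, Set.Finite.subset hI hK, rfl⟩, h.symm⟩

lemma projSet_subset (R T : X.Res) : X.projSet R.1 T.1 ⊆ R.1 := by
  obtain ⟨R, I, c, hI, rfl⟩ := R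
  rintro _ ⟨E, -, rfl⟩
  exact X.gate_mem I c E

lemma gate_gate (R T : X.Res) {D : X.Chamber} (hD : D ∈ X.projSet R.1 T.1) :
    X.gate R.1 (X.gate T.1 D) = D := by
  obtain ⟨R, I, c, hI, rfl⟩ := R
  obtain ⟨T, J, d, hJ, rfl⟩ := T
  obtain ⟨K, D₀, hK, h, h'⟩ := X.exists_projSet_eq_residue I J c d
  simp only at hD ⊢
  rw [h] at hD
  exact h' D hD

end Bldg

namespace Bldg

variable {cs : CoxeterSystem M W} (X : Bldg cs)

/-! ### Existence of apartments -/

/-- A partial isometry to an apartment extends one step across the wall of `s`: the chamber `C`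
is in the right relative position to `D` as soon as it is for one chamber `D₀` on the same side. -/
lemma delta_eq_simple_mul_of_descent {C₀ C : X.Chamber} {i : B}
    (hC : X.delta C₀ C = cs.simple i) (D₀ D : X.Chamber)
    (hD₀D : X.delta D₀ D = (X.delta C₀ D₀)⁻¹ * X.delta C₀ D)
    (hD₀ : cs.IsLeftDescent (X.delta C₀ D₀) i) (hD : cs.IsLeftDescent (X.delta C₀ D) i)
    (hCD₀ : X.delta C D₀ = cs.simple i * X.delta C₀ D₀) :
    X.delta C D = cs.simple i * X.delta C₀ D := by
  induction hn : cs.length (X.delta D₀ D) generalizing D₀ with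
  | zero =>
    rw [cs.length_eq_zero_iff, delta_eq_one_iff] at hn
    rw [← hn, hCD₀]
  | succ n ih =>
    obtain ⟨j, hj⟩ := cs.exists_leftDescent_of_ne_one (w := X.delta D₀ D) (by
      intro h1
      rw [h1] at hn
      simp at hn)
    rw [cs.isLeftDescent_iff] at hj
    obtain ⟨E, hD₀E, hDE⟩ := X.exists_delta D D₀ j
    have hED : X.delta E D = cs.simple j * X.delta D₀ D := by
      rw [X.delta_symm D E, hDE, X.delta_symm D₀ D]
      simp
    have hC₀E : X.delta C₀ E = X.delta C₀ D₀ * cs.simple j := by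
      rcases X.delta_mem_pair C₀ D₀ E j hD₀E with h | h
      · exact h
      · have := X.length_inv_mul_delta_le C₀ E D
        rw [h, ← hD₀D, hED] at this
        omega
    have hED' : X.delta E D = (X.delta C₀ E)⁻¹ * X.delta C₀ D := by
      rw [hED, hD₀D, hC₀E]
      simp [mul_assoc]
    have hwall := (cs.isReflection_simple i).isWall_one
    have hEdesc : cs.IsLeftDescent (X.delta C₀ E) i := by
      have hlen := cs.length_simple_mul (X.delta C₀ E) i
      by_contra hcon
      rw [CoxeterSystem.IsLeftDescent] at hcon hD₀ hD
      have h1 : cs.simple i * X.delta C₀ D₀ = X.delta C₀ D₀ * cs.simple j := by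
        refine hwall.mul_eq_of_cross _ j ?_
        simp only [Set.mem_ofPred_eq, ← hC₀E]
        omega
      have h2 := hwall.length_fold_lt (X.delta C₀ D) (X.delta C₀ E) (by
        simp only [Set.mem_ofPred_eq]
        omega)
      rw [← cs.length_inv, ← cs.length_inv ((X.delta C₀ D)⁻¹ * _), hC₀E, ← h1] at h2
      simp only [mul_inv_rev, cs.inv_simple, inv_inv, mul_assoc,
        cs.simple_mul_simple_cancel_left] at h2
      rw [← hD₀D] at h2
      have h3 : (X.delta C₀ D₀)⁻¹ * (cs.simple i * X.delta C₀ D) = X.delta E D := by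
        rw [hED', hC₀E, ← h1]
        simp [mul_assoc]
      rw [h3, hED] at h2
      omega
    have hCE : X.delta C E = cs.simple i * X.delta C₀ E := by
      rcases X.delta_mem_pair C D₀ E j hD₀E with h | h
      · rw [h, hCD₀, hC₀E, mul_assoc]
      · rcases X.delta_mem_pair E C₀ C i hC with h' | h'
        · rw [X.delta_symm E C, h', X.delta_symm C₀ E]
          simp
        · have h1 : X.delta C E = X.delta C₀ E := by
            rw [X.delta_symm E C, h', X.delta_symm C₀ E, inv_inv]
          rw [h, hCD₀] at h1
          rw [CoxeterSystem.IsLeftDescent, ← h1, cs.simple_mul_simple_cancel_left] at hEdesc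
          rw [CoxeterSystem.IsLeftDescent] at hD₀
          omega
    exact ih E hED' hEdesc hCE (by rw [hED]; omega)

lemma exists_extend (C₀ : X.Chamber) (i : B) (S : Set X.Chamber)
    (hS : ∀ D ∈ S, ∀ D' ∈ S, X.delta D D' = (X.delta C₀ D)⁻¹ * X.delta C₀ D') :
    ∃ C, ∀ D ∈ S, X.delta C D = cs.simple i * X.delta C₀ D := by
  have hasc : ∀ C, X.delta C₀ C = cs.simple i → ∀ D, ¬ cs.IsLeftDescent (X.delta C₀ D) i →
      X.delta C D = cs.simple i * X.delta C₀ D := by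
    intro C hC D hD
    rw [cs.not_isLeftDescent_iff] at hD
    have hC' := X.delta_eq_simple_symm hC
    rw [X.delta_eq_mul (E := C₀), hC']
    rw [hC', hD, cs.length_simple, add_comm]
  by_cases h : ∃ D₀ ∈ S, cs.IsLeftDescent (X.delta C₀ D₀) i
  · obtain ⟨D₀, hD₀S, hD₀⟩ := h
    obtain ⟨C, hC, hD₀C⟩ := X.exists_delta D₀ C₀ i
    refine ⟨C, fun D hD => ?_⟩
    by_cases hdesc : cs.IsLeftDescent (X.delta C₀ D) i
    · refine X.delta_eq_simple_mul_of_descent hC D₀ D (hS _ hD₀S _ hD) hD₀ hdesc ?_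
      rw [X.delta_symm D₀ C, hD₀C, X.delta_symm C₀ D₀]
      simp
    · exact hasc C hC D hdesc
  · push Not at h
    obtain ⟨C, hC, -⟩ := X.exists_delta C₀ C₀ i
    exact ⟨C, fun D hD => hasc C hC D (h D hD)⟩

/-- Any two chambers lie in a common apartment. -/
lemma exists_isApartMap (C D : X.Chamber) :
    ∃ α, X.IsApartMap α ∧ C ∈ Set.range α ∧ D ∈ Set.range α := by
  let Iso : Set (Set (W × X.Chamber)) :=
    {Γ | ∀ p ∈ Γ, ∀ q ∈ Γ, X.delta p.2 q.2 = p.1⁻¹ * q.1}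
  have h0 : ({(1, C), (X.delta C D, D)} : Set (W × X.Chamber)) ∈ Iso := by
    rintro _ (rfl | rfl) _ (rfl | rfl)
    · simp [delta_self]
    · simp
    · simp [X.delta_symm C D]
    · simp [delta_self]
  obtain ⟨Γ, hsub, hΓ⟩ := zorn_subset_nonempty Iso (by
    intro c hc hchain _
    refine ⟨⋃₀ c, ?_, fun s hs => Set.subset_sUnion_of_mem hs⟩
    rintro p ⟨s, hs, hp⟩ q ⟨t, ht, hq⟩
    rcases hchain.total hs ht with hst | hst
    · exact hc ht p (hst hp) q hq
    · exact hc hs p hp q (hst hq)) _ h0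
  have hiso : ∀ p ∈ Γ, ∀ q ∈ Γ, X.delta p.2 q.2 = p.1⁻¹ * q.1 := hΓ.prop
  have hstep : ∀ (i : B) (v : W), (∃ E, (v, E) ∈ Γ) → ∃ E, (v * cs.simple i, E) ∈ Γ := by
    rintro i v ⟨E, hE⟩
    obtain ⟨F, hF⟩ := X.exists_extend E i (Prod.snd '' Γ) (by
      rintro _ ⟨p, hp, rfl⟩ _ ⟨q, hq, rfl⟩
      rw [hiso p hp q hq, hiso _ hE p hp, hiso _ hE q hq]
      simp [mul_assoc])
    have hF' : ∀ p ∈ Γ, X.delta F p.2 = (v * cs.simple i)⁻¹ * p.1 := by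
      intro p hp
      rw [hF _ ⟨p, hp, rfl⟩, hiso _ hE p hp]
      simp [mul_assoc]
    refine ⟨F, ?_⟩
    have hins : insert (v * cs.simple i, F) Γ ∈ Iso := by
      rintro p (rfl | hp) q (rfl | hq)
      · simp [delta_self]
      · exact hF' q hq
      · rw [X.delta_symm, hF' p hp]
        simp
      · exact hiso p hp q hq
    exact hΓ.le_of_ge hins (Set.subset_insert _ _) (Set.mem_insert _ _)
  have hall : ∀ x v : W, (∃ E, (v, E) ∈ Γ) → ∃ E, (v * x, E) ∈ Γ := by
    intro x
    induction x using cs.simple_induction with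
    | simple i => exact hstep i
    | one => simp
    | mul x y hx hy =>
      intro v hv
      rw [← mul_assoc]
      exact hy _ (hx v hv)
  have h1 : (1, C) ∈ Γ := hsub (by simp)
  choose α hα using fun v : W => by simpa using hall v 1 ⟨C, h1⟩
  have hmem : ∀ p ∈ Γ, p.2 ∈ Set.range α := by
    intro p hp
    refine ⟨p.1, ?_⟩
    rw [← X.delta_eq_one_iff, hiso _ (hα p.1) p hp]
    simp
  refine ⟨α, ⟨fun v w hvw => ?_, fun v w => hiso _ (hα v) _ (hα w)⟩, hmem _ h1,
    hmem _ (hsub (Or.inr rfl))⟩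
  have := hiso _ (hα v) _ (hα w)
  simp only [hvw, delta_self] at this
  exact inv_mul_eq_one.1 this.symm

end Bldg

lemma CoxeterSystem.sepCard_preimage_mul (cs : CoxeterSystem M W) (g : W) (P Q : Set W) :
    cs.sepCard ((fun x => g * x) ⁻¹' P) ((fun x => g * x) ⁻¹' Q) = cs.sepCard P Q := by
  have hinj : Function.Injective (Set.preimage fun x => g * x) :=
    (Group.mulLeft_bijective g).surjective.preimage_injective
  have key : ∀ P : Set W, cs.halfspacesOver ((fun x => g * x) ⁻¹' P) =
      Set.preimage (fun x => g * x) '' cs.halfspacesOver P := by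
    intro P
    ext H
    constructor
    · rintro ⟨hH, hPH⟩
      refine ⟨(fun x => g⁻¹ * x) ⁻¹' H, ⟨preimage_mul_mem_halfspaces hH _, ?_⟩, ?_⟩
      · intro x hx
        exact hPH (by simpa using hx)
      · ext x
        simp
    · rintro ⟨H', ⟨hH', hPH'⟩, rfl⟩
      exact ⟨preimage_mul_mem_halfspaces hH' g, Set.preimage_mono hPH'⟩
  rw [sepCard, key, key, ← Set.image_symmDiff hinj, Set.ncard_image_of_injective _ hinj, sepCard]

namespace Bldg

variable {cs : CoxeterSystem M W} {X : Bldg cs} {α : W → X.Chamber}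

/-! ### Residues and roots in an apartment -/

namespace IsApartMap

lemma isCoset_preimage (hα : X.IsApartMap α) {I : Set B} {c : X.Chamber}
    (hne : (α ⁻¹' X.residue I c).Nonempty) : cs.IsCoset I (α ⁻¹' X.residue I c) where
  nonempty := hne
  mem_iff p hp x := by
    rw [← hα.2, ← X.mem_residue_iff hp, Set.mem_preimage]

lemma exists_isCoset (hα : X.IsApartMap α) (R : X.Res) (hne : (α ⁻¹' R.1).Nonempty) :
    ∃ I, cs.IsCoset I (α ⁻¹' R.1) ∧ (α ⁻¹' R.1).Finite := by
  obtain ⟨R, I, c, hI, rfl⟩ := R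
  have hP := hα.isCoset_preimage hne
  refine ⟨I, hP, ?_⟩
  obtain ⟨p, hp⟩ := hne
  refine (Set.Finite.image (fun x => p * x) hI).subset fun x hx => ?_
  exact ⟨p⁻¹ * x, (hP.mem_iff p hp x).1 hx, by simp⟩

/-- The inclusion of residues may be tested in an apartment. -/
lemma subset_of_preimage_subset (hα : X.IsApartMap α) (R R' : X.Res) (hne : (α ⁻¹' R.1).Nonempty)
    (h : α ⁻¹' R.1 ⊆ α ⁻¹' R'.1) : R.1 ⊆ R'.1 := by
  have hne' := hne.mono h
  obtain ⟨R, I, c, hI, rfl⟩ := R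
  obtain ⟨R', J, d, hJ, rfl⟩ := R'
  have hP := hα.isCoset_preimage hne
  have hP' := hα.isCoset_preimage hne'
  obtain ⟨p, hp⟩ := hne
  intro D hD
  refine (X.mem_residue_iff (h hp) D).2 ?_
  have h1 := (X.mem_residue_iff hp D).1 hD
  have h2 := (hP.mem_iff p hp (p * X.delta (α p) D)).2 (by simpa using h1)
  simpa using (hP'.mem_iff p (h hp) _).1 (h h2)

/-- The roots of an apartment are the images of the half-spaces of `W`. -/
lemma isRootOf_iff (hα : X.IsApartMap α) (φ : Set X.Chamber) :
    X.IsRootOf (Set.range α) φ ↔ ∃ H ∈ cs.halfspaces, φ = α '' H := by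
  constructor
  · rintro ⟨β, hβ, hrange, t, ht, rfl⟩
    obtain ⟨u, hu⟩ : β 1 ∈ Set.range α := hrange ▸ Set.mem_range_self 1
    have hβα : ∀ v, β v = α (u * v) := by
      intro v
      obtain ⟨y, hy⟩ : β v ∈ Set.range α := hrange ▸ Set.mem_range_self v
      have h1 := hβ.2 1 v
      rw [← hu, ← hy, hα.2, inv_one, one_mul] at h1
      rw [← hy, ← h1, mul_inv_cancel_left]
    refine ⟨_, ⟨u, t, ht, rfl⟩, ?_⟩
    ext D
    constructor
    · rintro ⟨v, hv, rfl⟩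
      exact ⟨u * v, by simpa [CoxeterSystem.halfspace] using hv, (hβα v).symm⟩
    · rintro ⟨x, hx, rfl⟩
      exact ⟨u⁻¹ * x, hx, by rw [hβα, mul_inv_cancel_left]⟩
  · rintro ⟨_, ⟨u, t, ht, rfl⟩, rfl⟩
    refine ⟨fun v => α (u * v), ⟨fun v w hvw => mul_left_cancel (hα.1 hvw), fun v w => ?_⟩, ?_,
      t, ht, ?_⟩
    · rw [hα.2]
      simp [mul_assoc]
    · exact ((Group.mulLeft_bijective u).surjective.range_comp α).symm
    · ext D
      constructor
      · rintro ⟨x, hx, rfl⟩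
        exact ⟨u⁻¹ * x, hx, by simp⟩
      · rintro ⟨v, hv, rfl⟩
        exact ⟨u * v, by simpa [CoxeterSystem.halfspace] using hv, rfl⟩

lemma containedInRoot_iff (hα : X.IsApartMap α) (R : X.Res) (H : Set W) :
    X.ContainedInRoot R (Set.range α) (α '' H) ↔ α ⁻¹' R.1 ⊆ H := by
  rw [ContainedInRoot, ← Set.image_preimage_eq_inter_range, Set.image_subset_image_iff hα.1]

lemma phiSep_eq (hα : X.IsApartMap α) (R T : X.Res) : X.PhiSep (Set.range α) R T =
    Set.image α '' (cs.halfspacesOver (α ⁻¹' R.1) \ cs.halfspacesOver (α ⁻¹' T.1)) := by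
  ext φ
  constructor
  · rintro ⟨h1, h2, h3⟩
    obtain ⟨H, hH, rfl⟩ := (hα.isRootOf_iff φ).1 h1
    rw [hα.containedInRoot_iff] at h2 h3
    exact ⟨H, ⟨⟨hH, h2⟩, fun h => h3 h.2⟩, rfl⟩
  · rintro ⟨H, ⟨⟨hH, h2⟩, h3⟩, rfl⟩
    refine ⟨(hα.isRootOf_iff _).2 ⟨H, hH, rfl⟩, (hα.containedInRoot_iff R H).2 h2, fun h => h3 ?_⟩
    exact ⟨hH, (hα.containedInRoot_iff T H).1 h⟩

lemma ncard_phiSep_add (hα : X.IsApartMap α) (R T : X.Res) (hR : (α ⁻¹' R.1).Nonempty)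
    (hT : (α ⁻¹' T.1).Nonempty) :
    (X.PhiSep (Set.range α) R T).ncard + (X.PhiSep (Set.range α) T R).ncard =
      cs.sepCard (α ⁻¹' R.1) (α ⁻¹' T.1) := by
  obtain ⟨_, -, hRf⟩ := hα.exists_isCoset R hR
  obtain ⟨_, -, hTf⟩ := hα.exists_isCoset T hT
  rw [cs.sepCard_eq_add hR hRf hT hTf, hα.phiSep_eq, hα.phiSep_eq,
    Set.ncard_image_of_injective _ hα.1.image_injective,
    Set.ncard_image_of_injective _ hα.1.image_injective]

/-- The number of roots separating two residues does not depend on the apartment. -/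
lemma sepCard_eq {β : W → X.Chamber} (hα : X.IsApartMap α) (hβ : X.IsApartMap β) (R T : X.Res)
    (hRα : (α ⁻¹' R.1).Nonempty) (hTα : (α ⁻¹' T.1).Nonempty)
    (hRβ : (β ⁻¹' R.1).Nonempty) (hTβ : (β ⁻¹' T.1).Nonempty) :
    cs.sepCard (β ⁻¹' R.1) (β ⁻¹' T.1) = cs.sepCard (α ⁻¹' R.1) (α ⁻¹' T.1) := by
  obtain ⟨R, I, c, hI, rfl⟩ := R
  obtain ⟨T, J, d, hJ, rfl⟩ := T
  have hP := hα.isCoset_preimage hRα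
  have hQ := hα.isCoset_preimage hTα
  have hP' := hβ.isCoset_preimage hRβ
  have hQ' := hβ.isCoset_preimage hTβ
  simp only at *
  obtain ⟨p', hp'⟩ := hRα
  obtain ⟨q', hq'⟩ := hTα
  obtain ⟨p, hp⟩ := hRβ
  obtain ⟨q, hq⟩ := hTβ
  have ha := X.inv_mul_delta_mem_closure (β q) ((X.mem_residue_iff hp' _).1 hp)
  have hb := X.inv_mul_delta_mem_closure (α p') ((X.mem_residue_iff hq' _).1 hq)
  rw [hβ.2, X.delta_symm (α p') (β q), inv_inv] at ha
  rw [hα.2] at hb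
  set x := X.delta (α p') (β q)
  set g := p' * (x * (q⁻¹ * p)) * p⁻¹ with hg
  have e1 : β ⁻¹' X.residue I c = (fun x => g * x) ⁻¹' (α ⁻¹' X.residue I c) := by
    ext y
    rw [hP'.mem_iff p hp, Set.mem_preimage (f := fun x => g * x), hP.mem_iff p' hp',
      ← Subgroup.mul_mem_cancel_left _ ha]
    simp [hg, mul_assoc]
  have e2 : β ⁻¹' X.residue J d = (fun x => g * x) ⁻¹' (α ⁻¹' X.residue J d) := by
    ext y
    rw [hQ'.mem_iff q hq, Set.mem_preimage (f := fun x => g * x), hQ.mem_iff q' hq',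
      ← Subgroup.mul_mem_cancel_left _ hb]
    simp [hg, mul_assoc]
  rw [e1, e2, cs.sepCard_preimage_mul]

/-- The root-distance may be computed in any apartment. -/
lemma rootDist_eq (hα : X.IsApartMap α) (R T : X.Res) (hR : (α ⁻¹' R.1).Nonempty)
    (hT : (α ⁻¹' T.1).Nonempty) :
    X.rootDist R T = (cs.sepCard (α ⁻¹' R.1) (α ⁻¹' T.1) : ℝ) / 2 := by
  have hlies : ∀ {β : W → X.Chamber} (S : X.Res),
      X.LiesIn S (Set.range β) ↔ (β ⁻¹' S.1).Nonempty := by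
    intro β S
    rw [LiesIn, ← Set.image_preimage_eq_inter_range, Set.image_nonempty]
  have hA := Classical.epsilon_spec (p := fun A : Set X.Chamber =>
    X.IsApartment A ∧ X.LiesIn R A ∧ X.LiesIn T A)
    ⟨_, ⟨α, hα, rfl⟩, (hlies R).2 hR, (hlies T).2 hT⟩
  change X.IsApartment (X.chooseApt R T) ∧ X.LiesIn R (X.chooseApt R T) ∧
    X.LiesIn T (X.chooseApt R T) at hA
  obtain ⟨⟨β, hβ, hβA⟩, hRA, hTA⟩ := hA
  rw [hβA, hlies] at hRA hTA
  rw [rootDist, hβA, hβ.ncard_phiSep_add R T hRA hTA, hα.sepCard_eq hβ R T hR hT hRA hTA]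

/-- Projections of residues may be computed in an apartment. -/
lemma isProj (hα : X.IsApartMap α) (R T : X.Res) (hR : (α ⁻¹' R.1).Nonempty)
    (hT : (α ⁻¹' T.1).Nonempty) :
    cs.IsProj (α ⁻¹' R.1) (α ⁻¹' T.1) (α ⁻¹' (X.projRes R T).1) := by
  have hclosest : ∀ (S : X.Res), (α ⁻¹' S.1).Nonempty → ∀ q,
      ∃ p, α p = X.gate S.1 (α q) ∧ cs.IsClosest (α ⁻¹' S.1) q p := by
    intro S hS q
    obtain ⟨S, I, c, hI, rfl⟩ := S
    have hP := hα.isCoset_preimage hS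
    obtain ⟨p, hp, hmin⟩ := exists_minimalFor_of_wellFoundedLT (· ∈ α ⁻¹' X.residue I c)
      (fun p => cs.length (q⁻¹ * p)) hS
    have hle : ∀ p' ∈ α ⁻¹' X.residue I c, cs.length (q⁻¹ * p) ≤ cs.length (q⁻¹ * p') := by
      intro p' hp'
      by_contra hlt
      exact hlt (hmin hp' (by simp only; omega))
    have hgate : X.IsGate I (α q) (α p) := by
      intro v hv
      rw [hα.2, mul_assoc]
      exact hle _ ((hP.mem_iff p hp _).2 (by simpa using hv))
    exact ⟨p, (hgate.gate_eq hp).symm, hp, hle⟩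
  constructor
  · intro q hq
    obtain ⟨p, hp, hpq⟩ := hclosest R hR q
    refine ⟨p, ?_, hpq⟩
    rw [Set.mem_preimage, X.projRes_coe, hp]
    exact ⟨_, hq, rfl⟩
  · intro p hp
    rw [Set.mem_preimage, X.projRes_coe] at hp
    obtain ⟨q, hq, hqp⟩ := hclosest T hT p
    obtain ⟨p', hp', hpq⟩ := hclosest R hR q
    rw [hq, X.gate_gate R T hp] at hp'
    exact ⟨q, hqp.1, hα.1 hp' ▸ hpq⟩

end IsApartMap

lemma Res.nonempty (R : X.Res) : R.1.Nonempty := by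
  obtain ⟨R, I, c, hI, rfl⟩ := R
  exact ⟨c, X.mem_residue_self I c⟩

/-- Any two spherical residues lie in a common apartment. -/
lemma exists_isApartMap_res (R T : X.Res) :
    ∃ α, X.IsApartMap α ∧ (α ⁻¹' R.1).Nonempty ∧ (α ⁻¹' T.1).Nonempty := by
  obtain ⟨C, hC⟩ := Res.nonempty R
  obtain ⟨D, hD⟩ := Res.nonempty T
  obtain ⟨α, hα, ⟨v, rfl⟩, ⟨w, rfl⟩⟩ := X.exists_isApartMap C D
  exact ⟨α, hα, ⟨v, hC⟩, ⟨w, hD⟩⟩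

end Bldg

/-- `proj_R(T)` is the unique maximal element of `[R,T]` containing
`R`, and the unique residue containing `R` at minimal root-distance from `T`. -/
theorem statement4 {cs : CoxeterSystem M W} (X : Bldg cs) (R T : X.Res) :
    (X.projRes R T ∈ X.interval R T ∧ X.leRes R (X.projRes R T) ∧
      ∀ σ ∈ X.interval R T, X.leRes R σ → X.leRes σ (X.projRes R T)) ∧
    ((∀ σ : X.Res, X.leRes R σ → X.rootDist (X.projRes R T) T ≤ X.rootDist σ T) ∧
      ∀ π : X.Res, X.leRes R π →
        (∀ σ : X.Res, X.leRes R σ → X.rootDist π T ≤ X.rootDist σ T) →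
        π = X.projRes R T) := by
  have hle : X.leRes R (X.projRes R T) := by
    rw [Bldg.leRes, X.projRes_coe]
    exact X.projSet_subset R T
  have hproj_ne : ∀ {α : W → X.Chamber}, X.IsApartMap α → (α ⁻¹' R.1).Nonempty →
      (α ⁻¹' T.1).Nonempty → (α ⁻¹' (X.projRes R T).1).Nonempty := by
    rintro α hα hR ⟨q, hq⟩
    obtain ⟨p, hp, -⟩ := (hα.isProj R T hR ⟨q, hq⟩).exists_proj q hq
    exact ⟨p, hp⟩
  refine ⟨⟨?_, hle, fun σ hσ hRσ => ?_⟩, fun σ hRσ => ?_, fun π hRπ hmin => ?_⟩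
  · obtain ⟨α, hα, hR, hT⟩ := Bldg.exists_isApartMap_res R T
    have hN := hproj_ne hα hR hT
    obtain ⟨I, hRI, hRf⟩ := hα.exists_isCoset R hR
    obtain ⟨J, hTJ, hTf⟩ := hα.exists_isCoset T hT
    have h := (hα.isProj R T hR hT).sepCard_add hRI hRf hN hT hTf
    rw [Bldg.interval, Set.mem_ofPred_eq, hα.rootDist_eq R T hR hT, hα.rootDist_eq R _ hR hN,
      hα.rootDist_eq _ T hN hT, h]
    push_cast
    ring
  · obtain ⟨α, hα, hσne, hT⟩ := Bldg.exists_isApartMap_res σ T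
    have hsub : α ⁻¹' σ.1 ⊆ α ⁻¹' R.1 := Set.preimage_mono hRσ
    have hR := hσne.mono hsub
    have hN := hproj_ne hα hR hT
    obtain ⟨I, hRI, hRf⟩ := hα.exists_isCoset R hR
    obtain ⟨J, hTJ, hTf⟩ := hα.exists_isCoset T hT
    obtain ⟨K, hσK, -⟩ := hα.exists_isCoset σ hσne
    rw [Bldg.interval, Set.mem_ofPred_eq, hα.rootDist_eq R T hR hT, hα.rootDist_eq R _ hR hσne,
      hα.rootDist_eq _ T hσne hT, ← add_div, div_left_inj' two_ne_zero] at hσ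
    norm_cast at hσ
    exact hα.subset_of_preimage_subset _ _ hN
      ((hα.isProj R T hR hT).subset_of_sepCard_add hRI hRf hN hT hTf hσK hsub hσ)
  · obtain ⟨α, hα, hσne, hT⟩ := Bldg.exists_isApartMap_res σ T
    have hsub : α ⁻¹' σ.1 ⊆ α ⁻¹' R.1 := Set.preimage_mono hRσ
    have hR := hσne.mono hsub
    have hN := hproj_ne hα hR hT
    obtain ⟨I, hRI, hRf⟩ := hα.exists_isCoset R hR
    obtain ⟨J, hTJ, hTf⟩ := hα.exists_isCoset T hT
    rw [hα.rootDist_eq _ T hN hT, hα.rootDist_eq _ T hσne hT]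
    have h := (hα.isProj R T hR hT).sepCard_le hRI hRf hN hT hTf hσne hsub
    gcongr
  · obtain ⟨α, hα, hπne, hT⟩ := Bldg.exists_isApartMap_res π T
    have hsub : α ⁻¹' π.1 ⊆ α ⁻¹' R.1 := Set.preimage_mono hRπ
    have hR := hπne.mono hsub
    have hN := hproj_ne hα hR hT
    obtain ⟨I, hRI, hRf⟩ := hα.exists_isCoset R hR
    obtain ⟨J, hTJ, hTf⟩ := hα.exists_isCoset T hT
    obtain ⟨K, hNK, -⟩ := hα.exists_isCoset _ hN
    obtain ⟨L, hπL, -⟩ := hα.exists_isCoset π hπne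
    have h := hmin _ hle
    rw [hα.rootDist_eq _ T hN hT, hα.rootDist_eq _ T hπne hT,
      div_le_div_iff_of_pos_right two_pos] at h
    norm_cast at h
    have e := (hα.isProj R T hR hT).eq_of_sepCard_le hRI hRf hNK hT hTf hπL hsub h
    exact Subtype.ext ((hα.subset_of_preimage_subset _ _ hπne e.le).antisymm
      (hα.subset_of_preimage_subset _ _ hN e.ge))
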